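/- Let 0 < γ < 2. For all integers n ≥ 0 and 0 ≤ m ≤ n, the point Z^γ(n,m) lies in the closed sector B = {r·e^{iφ} : r ≥ 0, 0 ≤ φ ≤ γπ/4} of the complex plane. -/

import Mathlib

open Complex Real

noncomputable section

/-- The cross-ratio equation (q): all elementary quadrilaterals are conformal squares. -/
def CrossRatioEq (f : ℕ → ℕ → ℂ) : Prop :=
  ∀ n m : ℕ,
    ((f n m - f (n + 1) m) * (f (n + 1) (m + 1) - f n (m + 1))) /
      ((f (n + 1) m - f (n + 1) (m + 1)) * (f n (m + 1) - f n m)) = -1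

/-- The nonautonomous constraint (c) with parameter `γ`.  When `n = 0` (resp. `m = 0`)
the first (resp. second) summand vanishes, since its coefficient `2*n` (resp. `2*m`) is `0`. -/
def ConstraintC (γ : ℝ) (f : ℕ → ℕ → ℂ) : Prop :=
  ∀ n m : ℕ,
    (γ : ℂ) * f n m =
      2 * (n : ℂ) * ((f (n + 1) m - f n m) * (f n m - f (n - 1) m)) /
          (f (n + 1) m - f (n - 1) m) +
      2 * (m : ℂ) * ((f n (m + 1) - f n m) * (f n m - f n (m - 1))) /
          (f n (m + 1) - f n (m - 1))

/-- Initial data `f 0 0 = 0`, `f 1 0 = 1`, `f 0 1 = exp (i α)`. -/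
def InitialData (f : ℕ → ℕ → ℂ) (α : ℝ) : Prop :=
  f 0 0 = 0 ∧ f 1 0 = 1 ∧ f 0 1 = Complex.exp ((α : ℂ) * Complex.I)

/-- The open interior of the elementary quadrilateral
`(f n m, f (n+1) m, f (n+1) (m+1), f n (m+1))`. -/
def quadInterior (f : ℕ → ℕ → ℂ) (n m : ℕ) : Set ℂ :=
  interior (convexHull ℝ {f n m, f (n + 1) m, f (n + 1) (m + 1), f n (m + 1)})

/-- A discrete conformal map is embedded if interiors of distinct elementary
quadrilaterals are pairwise disjoint. -/
def Embedded (f : ℕ → ℕ → ℂ) : Prop :=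
  ∀ n m n' m' : ℕ, (n, m) ≠ (n', m') →
    Disjoint (quadInterior f n m) (quadInterior f n' m')

/-- Two elementary quadrilaterals are adjacent if their base points are lattice neighbours. -/
def AdjacentQuads (n m n' m' : ℕ) : Prop :=
  (n = n' ∧ (m + 1 = m' ∨ m' + 1 = m)) ∨ (m = m' ∧ (n + 1 = n' ∨ n' + 1 = n))

/-- A discrete conformal map is an immersion if interiors of adjacent elementary
quadrilaterals are disjoint. -/
def Immersed (f : ℕ → ℕ → ℂ) : Prop :=
  ∀ n m n' m' : ℕ, AdjacentQuads n m n' m' →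
    Disjoint (quadInterior f n m) (quadInterior f n' m')

def uu (f : ℕ → ℕ → ℂ) (n m : ℕ) : ℂ := f (n+1) m - f n m
def vv (f : ℕ → ℕ → ℂ) (n m : ℕ) : ℂ := f n (m+1) - f n m

lemma uu_ne {f : ℕ → ℕ → ℂ} (hq : CrossRatioEq f) (n m : ℕ) : uu f n m ≠ 0 := by
  intro h
  have h1 := hq n m
  have : f n m - f (n+1) m = 0 := by unfold uu at h; linear_combination -h
  rw [this] at h1
  simp at h1

lemma vv_ne {f : ℕ → ℕ → ℂ} (hq : CrossRatioEq f) (n m : ℕ) : vv f n m ≠ 0 := by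
  intro h
  have h1 := hq n m
  unfold vv at h
  rw [h] at h1
  simp at h1

lemma q_mul {f : ℕ → ℕ → ℂ} (hq : CrossRatioEq f) (n m : ℕ) :
    uu f n m * uu f n (m+1) = - (vv f n m * vv f (n+1) m) := by
  have h1 := hq n m
  have h2 : (f (n + 1) m - f (n + 1) (m + 1)) * (f n (m + 1) - f n m) ≠ 0 := by
    intro h; rw [h] at h1; simp at h1
  rw [div_eq_iff h2] at h1
  unfold uu vv
  linear_combination -h1

lemma uv_close (f : ℕ → ℕ → ℂ) (n m : ℕ) :
    uu f n m + vv f (n+1) m = vv f n m + uu f n (m+1) := by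
  unfold uu vv; ring

lemma q_v {f : ℕ → ℕ → ℂ} (hq : CrossRatioEq f) (n m : ℕ) :
    vv f (n+1) m * (uu f n m + vv f n m) = uu f n m * (vv f n m - uu f n m) := by
  have h1 := q_mul hq n m
  have h2 := uv_close f n m
  linear_combination uu f n m * h2 + h1

lemma q_u {f : ℕ → ℕ → ℂ} (hq : CrossRatioEq f) (n m : ℕ) :
    uu f n (m+1) * (uu f n m + vv f n m) = vv f n m * (uu f n m - vv f n m) := by
  have h1 := q_mul hq n m
  have h2 := uv_close f n m
  linear_combination h1 - vv f n m * h2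

lemma q_sum_ne {f : ℕ → ℕ → ℂ} (hq : CrossRatioEq f) (n m : ℕ) :
    uu f n m + vv f n m ≠ 0 := by
  intro h
  have h1 := q_v hq n m
  rw [h, mul_zero] at h1
  have h2 : vv f n m - uu f n m = 0 := by
    rcases mul_eq_zero.1 h1.symm with h | h
    · exact absurd h (uu_ne hq n m)
    · exact h
  have : 2 * uu f n m = 0 := by linear_combination h - h2
  exact uu_ne hq n m (by simpa using this)

/-- axis sequence step sizes -/
def UU (γ : ℝ) : ℕ → ℝ
  | 0 => 1
  | (n+1) => if Even n then (n + γ) / (n + 2 - γ) * UU γ n else UU γ n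

lemma UU_pos {γ : ℝ} (h0 : 0 < γ) (h2 : γ < 2) (n : ℕ) : 0 < UU γ n := by
  induction n with
  | zero => simp [UU]
  | succ n ih =>
    have hn : (0:ℝ) ≤ n := Nat.cast_nonneg n
    unfold UU
    split_ifs
    · have : 0 < (n:ℝ) + 2 - γ := by linarith
      positivity
    · exact ih

lemma UU_even {γ : ℝ} {n : ℕ} (h : Even n) : UU γ (n+1) = (n + γ) / (n + 2 - γ) * UU γ n := by
  simp [UU, h]
lemma UU_odd {γ : ℝ} {n : ℕ} (h : ¬ Even n) : UU γ (n+1) = UU γ n := by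
  simp [UU, h]

lemma axis_seq {γ : ℝ} (h0 : 0 < γ) (h2 : γ < 2) (x : ℕ → ℂ) (x0 : x 0 = 0) (x1 : x 1 = 1)
    (hc : ∀ n : ℕ, (γ:ℂ) * x (n+1) = 2 * ((n+1 : ℕ):ℂ) * ((x (n+2) - x (n+1)) * (x (n+1) - x n)) /
      (x (n+2) - x n)) (n : ℕ) :
    x (n+1) - x n = (UU γ n : ℂ) ∧
      (γ:ℂ) * x n = (if Even n then (n:ℂ) else (n:ℂ) + 1 - γ) * (UU γ n : ℂ) := by
  induction n with
  | zero => simp [x0, x1, UU]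
  | succ n ih =>
    obtain ⟨i1, i2⟩ := ih
    have hU := UU_pos h0 h2 n
    have hn : (0:ℝ) ≤ n := Nat.cast_nonneg n
    have hUc : (UU γ n : ℂ) ≠ 0 := by exact_mod_cast hU.ne'
    have hd : (n:ℝ) + 2 - γ ≠ 0 := by linarith
    have hdc : (n:ℂ) + 2 - γ ≠ 0 := by exact_mod_cast hd
    have hgc : (n:ℂ) + γ ≠ 0 := by
      have : (n:ℝ) + γ ≠ 0 := by linarith
      exact_mod_cast this
    have hn1 : (n:ℂ) + 1 ≠ 0 := by
      have : (n:ℝ) + 1 ≠ 0 := by linarith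
      exact_mod_cast this
    have hx : (γ:ℂ) * x (n+1) = (if Even n then (n:ℂ) + γ else (n:ℂ) + 1) * (UU γ n : ℂ) := by
      have : (γ:ℂ) * x (n+1) = γ * x n + γ * UU γ n := by rw [← i1]; ring
      rw [this, i2]
      split_ifs <;> ring
    have h3 := hc n
    have hne : x (n+2) - x n ≠ 0 := by
      intro h
      rw [h, div_zero, hx] at h3
      split_ifs at h3
      · exact (mul_ne_zero hgc hUc) h3
      · exact (mul_ne_zero hn1 hUc) h3
    rw [eq_div_iff hne, hx, i1] at h3
    have h4 : x (n+2) - x n = (x (n+1+1) - x (n+1)) + UU γ n := by rw [← i1]; ring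
    rw [h4] at h3
    push_cast at h3 ⊢
    by_cases he : Even n
    · rw [UU_even he]
      simp only [he, if_true] at h3
      have he' : ¬ Even (n+1) := by rw [Nat.even_add_one]; simpa using he
      simp only [he', if_false]
      have h5 : x (n+1+1) - x (n+1) = ((((n:ℝ) + γ) / (n + 2 - γ) * UU γ n : ℝ) : ℂ) := by
        push_cast
        rw [div_mul_eq_mul_div, eq_div_iff hdc]
        have h6 : (UU γ n : ℂ) * ((x (n+1+1) - x (n+1)) * (n + 2 - γ)) = UU γ n * ((n + γ) * UU γ n) := by
          linear_combination -h3
        exact mul_left_cancel₀ hUc h6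
      refine ⟨h5, ?_⟩
      rw [hx, if_pos he]; push_cast; field_simp
      ring
    · rw [UU_odd he]
      simp only [he, if_false] at h3
      have he' : Even (n+1) := by rw [Nat.even_add_one]; simpa using he
      simp only [he', if_true]
      have h5 : x (n+1+1) - x (n+1) = ((UU γ n : ℝ) : ℂ) := by
        have h6 : (UU γ n : ℂ) * (n+1) * (x (n+1+1) - x (n+1)) = UU γ n * (n+1) * UU γ n := by
          linear_combination -h3
        exact mul_left_cancel₀ (mul_ne_zero hUc hn1) h6
      refine ⟨h5, ?_⟩
      rw [hx, if_neg he]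

structure ZSetup (γ : ℝ) (f : ℕ → ℕ → ℂ) : Prop where
  h0 : 0 < γ
  h2 : γ < 2
  q : CrossRatioEq f
  c : ConstraintC γ f
  i : InitialData f (γ * Real.pi / 2)

/-- the unit number on the diagonal ray -/
def ea (γ : ℝ) : ℂ := Complex.exp ((γ * Real.pi / 4 : ℝ) * Complex.I)

lemma ea_conj (γ : ℝ) : ea γ * (starRingEnd ℂ) (ea γ) = 1 := by
  rw [Complex.mul_conj, Complex.normSq_eq_norm_sq]
  unfold ea
  rw [Complex.norm_exp_ofReal_mul_I]; simp

lemma ea_ne (γ : ℝ) : ea γ ≠ 0 := Complex.exp_ne_zero _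
lemma ea_norm (γ : ℝ) : ‖ea γ‖ = 1 := by
  unfold ea
  rw [Complex.norm_exp_ofReal_mul_I]

namespace ZSetup
variable {γ : ℝ} {f : ℕ → ℕ → ℂ}

lemma f00 (H : ZSetup γ f) : f 0 0 = 0 := H.i.1
lemma f10 (H : ZSetup γ f) : f 1 0 = 1 := H.i.2.1
lemma f01 (H : ZSetup γ f) : f 0 1 = ea γ ^ 2 := by
  rw [H.i.2.2, ea, ← Complex.exp_nat_mul]; congr 1; push_cast; ring

lemma ax (H : ZSetup γ f) (n : ℕ) : uu f n 0 = (UU γ n : ℂ) ∧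
    (γ:ℂ) * f n 0 = (if Even n then (n:ℂ) else (n:ℂ) + 1 - γ) * (UU γ n : ℂ) := by
  refine axis_seq H.h0 H.h2 (fun n => f n 0) H.f00 H.f10 (fun k => ?_) n
  have := H.c (k+1) 0
  simpa using this

lemma ay (H : ZSetup γ f) (n : ℕ) : f 0 n = ea γ ^ 2 * f n 0 := by
  have hw : ea γ ^ 2 ≠ 0 := pow_ne_zero _ (ea_ne γ)
  have key : ∀ n, f 0 (n+1) / ea γ ^ 2 - f 0 n / ea γ ^ 2 = (UU γ n : ℂ) := by
    intro n
    refine (axis_seq H.h0 H.h2 (fun n => f 0 n / ea γ ^ 2) (by simp [H.f00]) (by simp [H.f01, hw])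
      (fun k => ?_) n).1
    have := H.c 0 (k+1)
    simp only [Nat.cast_zero, mul_zero, zero_mul, zero_div, zero_add, Nat.add_sub_cancel] at this
    generalize ea γ ^ 2 = w at *
    rw [show ((γ:ℂ) * (f 0 (k+1) / w)) = (γ * f 0 (k+1)) / w by ring, this]
    by_cases h : f 0 (k+2) - f 0 k = 0
    · have : f 0 (k+2) / w - f 0 k / w = 0 := by rw [← sub_div, h, zero_div]
      rw [this, show k+1+1 = k+2 from rfl, h]; simp
    · rw [show k+1+1 = k+2 from rfl, ← sub_div, ← sub_div, ← sub_div]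
      field_simp
  induction n with
  | zero => simp [H.f00]
  | succ n ih =>
    have h1 := key n
    have h2 := (H.ax n).1
    rw [← h2, ← sub_div, div_eq_iff hw] at h1
    unfold uu at h1
    linear_combination h1 + ih

lemma ax_real (H : ZSetup γ f) (n : ℕ) : ∃ x : ℝ, 0 ≤ x ∧ f n 0 = x := by
  induction n with
  | zero => exact ⟨0, le_refl _, by simp [H.f00]⟩
  | succ n ih =>
    obtain ⟨x, hx, h⟩ := ih
    refine ⟨x + UU γ n, add_nonneg hx (UU_pos H.h0 H.h2 n).le, ?_⟩
    have := (H.ax n).1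
    unfold uu at this
    push_cast
    linear_combination this + h

lemma sym (H : ZSetup γ f) (n : ℕ) : ∀ m, f m n = ea γ ^ 2 * (starRingEnd ℂ) (f n m) := by
  have hc1 := ea_conj γ
  have hw : ea γ ^ 2 ≠ 0 := pow_ne_zero _ (ea_ne γ)
  induction n with
  | zero =>
    intro m
    rw [H.ay m]
    obtain ⟨x, _, hx⟩ := H.ax_real m
    rw [hx]
    simp only [map_mul, map_pow, Complex.conj_ofReal]
    linear_combination (-x * (ea γ * (starRingEnd ℂ) (ea γ) + 1) ) * hc1
  | succ n ihn =>
    intro m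
    induction m with
    | zero =>
      rw [H.ay (n+1)]
      obtain ⟨x, _, hx⟩ := H.ax_real (n+1)
      rw [hx, Complex.conj_ofReal]
    | succ m ihm =>
      have e1 : uu f m n = ea γ ^ 2 * (starRingEnd ℂ) (vv f n m) := by
        unfold uu vv; rw [ihn m, ihn (m+1), map_sub]; ring
      have e2 : vv f m n = ea γ ^ 2 * (starRingEnd ℂ) (uu f n m) := by
        unfold uu vv; rw [ihn m, ihm, map_sub]; ring
      have a := q_v H.q m n
      have b := congrArg (starRingEnd ℂ) (q_u H.q n m)
      simp only [map_mul, map_add, map_sub] at b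
      have hs := q_sum_ne H.q m n
      have : vv f (m+1) n = ea γ ^ 2 * (starRingEnd ℂ) (uu f n (m+1)) := by
        apply mul_right_cancel₀ hs
        rw [a, e1, e2]
        linear_combination -(ea γ ^ 2) ^ 2 * b
      unfold vv uu at this
      rw [map_sub, ihn (m+1)] at this
      linear_combination this

lemma diag (H : ZSetup γ f) (n : ℕ) : ∃ x : ℝ, f n n = ea γ * x := by
  have h1 := H.sym n n
  have hc1 := ea_conj γ
  have : (starRingEnd ℂ) (f n n * (starRingEnd ℂ) (ea γ)) = f n n * (starRingEnd ℂ) (ea γ) := by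
    simp only [map_mul, Complex.conj_conj]
    conv_rhs => rw [h1]
    linear_combination (-(starRingEnd ℂ) (f n n) * ea γ) * hc1
  obtain ⟨x, hx⟩ := Complex.conj_eq_iff_real.1 this
  refine ⟨x, ?_⟩
  rw [← hx]
  linear_combination (-f n n) * hc1

end ZSetup

lemma quad_even {R : ℝ} {e g v : ℂ} (he : ‖e‖ = 1) (hg : ‖g‖ = 1) (hR : R ≠ 0)
    (hs : R * e + I * R * g ≠ 0)
    (h : v * (R * e + I * R * g) = R * e * (I * R * g - R * e)) :
    ∃ r : ℝ, v = I * r * e := by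
  have he1 : e * (starRingEnd ℂ) e = 1 := by rw [Complex.mul_conj, Complex.normSq_eq_norm_sq, he]; simp
  have hg1 : g * (starRingEnd ℂ) g = 1 := by rw [Complex.mul_conj, Complex.normSq_eq_norm_sq, hg]; simp
  have hRc : (R:ℂ) ≠ 0 := by exact_mod_cast hR
  have hs' : e + I * g ≠ 0 := by
    intro h; apply hs; linear_combination R * h
  have he0 : e ≠ 0 := by intro h; rw [h] at he; simp at he
  have hs2 : (starRingEnd ℂ) (e + I * g) ≠ 0 := (map_ne_zero _).2 hs'
  have hx : (starRingEnd ℂ) ((g + I * e) / (e + I * g)) = (g + I * e) / (e + I * g) := by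
    rw [map_div₀, div_eq_div_iff hs2 hs']
    simp only [map_add, map_mul, Complex.conj_I]
    have := Complex.I_sq
    linear_combination (-2*I) * he1 + 2*I*hg1 + ((starRingEnd ℂ) g * e - (starRingEnd ℂ) e * g) * this
  obtain ⟨x, hx⟩ := Complex.conj_eq_iff_real.1 hx
  refine ⟨R * x, ?_⟩
  push_cast
  rw [← hx]
  field_simp
  have : R * (v * (e + I * g)) = R * (R * e * (I * g - e)) := by linear_combination h
  have := mul_left_cancel₀ hRc this
  rw [this]
  linear_combination -R * e ^ 2 * Complex.I_sq

lemma quad_odd {R S : ℝ} {e v : ℂ} (he : ‖e‖ = 1)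
    (hs : R * e + I * S * e ≠ 0)
    (h : v * (R * e + I * S * e) = R * e * (I * S * e - R * e)) :
    ‖v‖ = |R| := by
  have h1 := congrArg norm h
  rw [norm_mul, norm_mul, norm_mul] at h1
  have h2 : ‖I * S * e - R * e‖ = ‖R * e + I * S * e‖ := by
    rw [← sub_mul, ← add_mul, norm_mul, norm_mul]
    congr 1
    rw [Complex.norm_eq_sqrt_sq_add_sq, Complex.norm_eq_sqrt_sq_add_sq]
    simp
  rw [h2, he] at h1
  have := mul_right_cancel₀ (norm_ne_zero_iff.2 hs) h1
  rw [this]; simp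

/-- kite data, `.1` radius, `.2` direction -/
def KX (f : ℕ → ℕ → ℂ) : ℕ → ℕ → ℝ × ℂ
  | 0, n => ((uu f n 0).re, 1)
  | (m+1), n => ((vv f n m / (I * (KX f m n).2)).re, vv f n m / (I * ((KX f m n).1 : ℂ)))

lemma KX_succ1 {f : ℕ → ℕ → ℂ} {n m : ℕ} {r : ℝ} (he : ‖(KX f m n).2‖ = 1)
    (h : vv f n m = I * r * (KX f m n).2) : (KX f (m+1) n).1 = r := by
  have : (KX f m n).2 ≠ 0 := by intro h; rw [h] at he; simp at he
  simp only [KX]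
  rw [h, show I * (r:ℂ) * (KX f m n).2 / (I * (KX f m n).2) = r by field_simp]
  simp

lemma KX_succ2 {f : ℕ → ℕ → ℂ} {n m : ℕ} (hR : (KX f m n).1 ≠ 0)
    (h : ‖vv f n m‖ = |(KX f m n).1|) : ‖(KX f (m+1) n).2‖ = 1 ∧
      vv f n m = I * (KX f m n).1 * (KX f (m+1) n).2 := by
  have : ((KX f m n).1 : ℂ) ≠ 0 := by exact_mod_cast hR
  simp only [KX]
  constructor
  · rw [norm_div, norm_mul, h]; simp [hR]
  · field_simp

/-- row invariant -/
def KInv (f : ℕ → ℕ → ℂ) (m : ℕ) : Prop :=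
  (∀ n, (Even (n+m) → (KX f m n).1 ≠ 0 ∧ uu f n m = (KX f m n).1 * (KX f m (n+1)).2) ∧
    (¬ Even (n+m) → ‖(KX f m n).2‖ = 1 ∧ uu f n m = (KX f m (n+1)).1 * (KX f m n).2))

def KW (f : ℕ → ℕ → ℂ) (n m : ℕ) : Prop :=
  (Even (n+m) → ‖vv f n m‖ = |(KX f m n).1|) ∧
    (¬ Even (n+m) → ∃ r : ℝ, vv f n m = I * r * (KX f m n).2)

def KV (f : ℕ → ℕ → ℂ) (n m : ℕ) : Prop :=
  (Even (n+m) → ‖(KX f (m+1) n).2‖ = 1 ∧ vv f n m = I * (KX f m n).1 * (KX f (m+1) n).2) ∧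
    (¬ Even (n+m) → vv f n m = I * (KX f (m+1) n).1 * (KX f m n).2)

lemma KV_of {f : ℕ → ℕ → ℂ} {n m : ℕ} (h : KInv f m) (hw : KW f n m) : KV f n m := by
  constructor
  · intro he
    exact KX_succ2 ((h n).1 he).1 (hw.1 he)
  · intro he
    obtain ⟨r, hr⟩ := hw.2 he
    rw [KX_succ1 ((h n).2 he).1 hr]
    exact hr

lemma KW_succ {f : ℕ → ℕ → ℂ} (hq : CrossRatioEq f) {n m : ℕ} (h : KInv f m) (hw : KW f n m) :
    KW f (n+1) m := by
  have hv := KV_of h hw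
  have hs := q_sum_ne hq n m
  have h1 := q_v hq n m
  constructor
  · intro he
    have he' : ¬ Even (n+m) := by rw [show n+1+m = n+m+1 by ring, Nat.even_add_one] at he; exact he
    obtain ⟨a1, a2⟩ := (h n).2 he'
    have a3 := hv.2 he'
    rw [a2, a3] at hs h1
    exact quad_odd a1 hs h1
  · intro he
    have he' : Even (n+m) := by rw [show n+1+m = n+m+1 by ring, Nat.even_add_one] at he; simpa using he
    obtain ⟨a1, a2⟩ := (h n).1 he'
    obtain ⟨a4, a3⟩ := hv.1 he'
    rw [a2, a3] at hs h1
    exact quad_even ((h (n+1)).2 he).1 a4 a1 hs h1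

lemma KInv_succ {f : ℕ → ℕ → ℂ} (hq : CrossRatioEq f) {m : ℕ} (h : KInv f m)
    (hw : ∀ n, KW f n m) : KInv f (m+1) := by
  intro n
  have hv := KV_of h (hw n)
  have hv1 := KV_of h (hw (n+1))
  have h1 := q_mul hq n m
  have hu := uu_ne hq n m
  have eqv : Even (n+1+m) ↔ ¬ Even (n+m) := by
    rw [show n+1+m = n+m+1 by ring, Nat.even_add_one]
  have eqv' : Even (n+(m+1)) ↔ ¬ Even (n+m) := by
    rw [show n+(m+1) = n+m+1 by ring, Nat.even_add_one]
  rw [eqv', not_not]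
  constructor
  · intro he
    have a1 := hv.2 he
    obtain ⟨a2, a3⟩ := hv1.1 (eqv.2 he)
    obtain ⟨a4, a5⟩ := (h n).2 he
    refine ⟨?_, ?_⟩
    · intro h0
      apply vv_ne hq n m
      rw [a1, h0]; simp
    · apply mul_left_cancel₀ hu
      rw [h1, a1, a3, a5]
      linear_combination (-(KX f (m + 1) n).1 * (KX f m n).2 * (KX f m (n + 1)).1 * (KX f (m + 1) (n + 1)).2) * Complex.I_sq
  · intro he
    obtain ⟨a0, a1⟩ := hv.1 he
    have a3 := hv1.2 (by rw [eqv]; simpa using he)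
    obtain ⟨a4, a5⟩ := (h n).1 he
    refine ⟨a0, ?_⟩
    apply mul_left_cancel₀ hu
    rw [h1, a1, a3, a5]
    linear_combination (-(KX f (m + 1) n).2 * (KX f m n).1 * (KX f m (n + 1)).2 * (KX f (m + 1) (n + 1)).1) * Complex.I_sq

namespace ZSetup
variable {γ : ℝ} {f : ℕ → ℕ → ℂ}

lemma vv0 (H : ZSetup γ f) (m : ℕ) : vv f 0 m = ea γ ^ 2 * UU γ m := by
  rw [← (H.ax m).1]; unfold vv uu; rw [H.ay, H.ay]; ring

lemma kinv (H : ZSetup γ f) (m : ℕ) : KInv f m ∧ KW f 0 m := by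
  induction m with
  | zero =>
    refine ⟨fun n => ⟨fun he => ⟨?_, ?_⟩, fun he => ⟨?_, ?_⟩⟩, fun _ => ?_, fun h => ?_⟩
    · simp only [KX, (H.ax n).1, Complex.ofReal_re]
      exact (UU_pos H.h0 H.h2 n).ne'
    · simp only [KX, (H.ax n).1, Complex.ofReal_re, mul_one]
    · simp [KX]
    · simp only [KX, (H.ax n).1, (H.ax (n+1)).1, Complex.ofReal_re, mul_one]
      rw [UU_odd (by simpa using he)]
    · rw [H.vv0]
      simp [KX, (H.ax 0).1, ea_norm]
    · simp at h
  | succ m ih =>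
    obtain ⟨h1, h2⟩ := ih
    have hw : ∀ n, KW f n m := by
      intro n
      induction n with
      | zero => exact h2
      | succ n ih => exact KW_succ H.q h1 ih
    refine ⟨KInv_succ H.q h1 hw, ?_⟩
    have hv := KV_of h1 h2
    unfold KV at hv
    unfold KW
    rw [zero_add] at hv
    rw [zero_add, Nat.even_add_one, not_not]
    constructor
    · intro he
      rw [H.vv0, UU_odd he, ← H.vv0, hv.2 he]
      simp only [norm_mul, ((h1 0).2 (by simpa using he)).1]
      simp
    · intro he
      have h3 := (hv.1 he).2
      have hU := UU_pos H.h0 H.h2 m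
      have hUc : (UU γ m : ℂ) ≠ 0 := by exact_mod_cast hU.ne'
      refine ⟨UU γ (m+1) / UU γ m * (KX f m 0).1, ?_⟩
      have : vv f 0 (m+1) = UU γ (m+1) / UU γ m * vv f 0 m := by
        rw [H.vv0, H.vv0]; field_simp
      rw [this, h3]; push_cast; ring

/-- kite radii and directions -/
structure Kites (γ : ℝ) (f : ℕ → ℕ → ℂ) (R : ℕ → ℕ → ℝ) (e : ℕ → ℕ → ℂ) : Prop where
  ax : ∀ n, R n 0 = UU γ n
  ne : ∀ n m, Even (n+m) → R n m ≠ 0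
  eu : ∀ n m, Even (n+m) → uu f n m = R n m * e (n+1) m
  ev : ∀ n m, Even (n+m) → vv f n m = I * R n m * e n (m+1)
  no : ∀ n m, ¬ Even (n+m) → ‖e n m‖ = 1
  ou : ∀ n m, ¬ Even (n+m) → uu f n m = R (n+1) m * e n m
  ov : ∀ n m, ¬ Even (n+m) → vv f n m = I * R n (m+1) * e n m

lemma kites (H : ZSetup γ f) : ∃ R e, Kites γ f R e := by
  have hw : ∀ n m, KW f n m := by
    intro n m
    induction n with
    | zero => exact (H.kinv m).2
    | succ n ih => exact KW_succ H.q (H.kinv m).1 ih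
  have hv : ∀ n m, KV f n m := fun n m => KV_of (H.kinv m).1 (hw n m)
  refine ⟨fun n m => (KX f m n).1, fun n m => (KX f m n).2, ?_, ?_, ?_, ?_, ?_, ?_, ?_⟩
  · intro n; simp [KX, (H.ax n).1]
  · intro n m h; exact (((H.kinv m).1 n).1 h).1
  · intro n m h; exact (((H.kinv m).1 n).1 h).2
  · intro n m h; exact ((hv n m).1 h).2
  · intro n m h; exact (((H.kinv m).1 n).2 h).1
  · intro n m h; exact (((H.kinv m).1 n).2 h).2
  · intro n m h; exact ((hv n m).2 h)

end ZSetup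

/-- the right half plane -/
def RH : Set ℂ := {z | 0 < z.re}
lemma RH_open : IsOpen RH := isOpen_lt continuous_const Complex.continuous_re
lemma RH_ne {z : ℂ} (h : z ∈ RH) : z ≠ 0 := by
  rintro rfl; simp [RH] at h
lemma RH_add {z w : ℂ} (h : z ∈ RH) (h' : w ∈ RH) : z + w ≠ 0 := by
  intro h1
  have := congrArg Complex.re h1
  simp [RH] at *
  linarith

lemma ext_off {F G : ℂ → ℂ} {S : Set ℂ} (hS : S.Finite) (hF : ContinuousOn F RH)
    (hG : ContinuousOn G RH) (h : ∀ z ∈ RH, z ∉ S → F z = G z) : ∀ z ∈ RH, F z = G z := by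
  intro a ha
  have hn : RH ∈ nhds a := RH_open.mem_nhds ha
  have h1 : Filter.Tendsto F (nhdsWithin a {a}ᶜ) (nhds (F a)) :=
    ((hF.continuousAt hn).tendsto).mono_left nhdsWithin_le_nhds
  have h2 : Filter.Tendsto G (nhdsWithin a {a}ᶜ) (nhds (G a)) :=
    ((hG.continuousAt hn).tendsto).mono_left nhdsWithin_le_nhds
  have h3 : F =ᶠ[nhdsWithin a {a}ᶜ] G := by
    have h4 : (S \ {a})ᶜ ∈ nhds a :=
      ((hS.subset Set.sdiff_subset).isClosed.isOpen_compl).mem_nhds (by simp)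
    filter_upwards [mem_nhdsWithin_of_mem_nhds hn, mem_nhdsWithin_of_mem_nhds h4,
      self_mem_nhdsWithin] with x hx hx1 hx2
    apply h x hx
    intro hxS
    exact hx1 ⟨hxS, hx2⟩
  exact tendsto_nhds_unique (h1.congr' h3) h2

/-- the node -/
def pp : ℂ := ⟨√2/2, √2/2⟩
lemma pp_re : pp.re = √2/2 := rfl
lemma pp_im : pp.im = √2/2 := rfl
lemma pp_RH : pp ∈ RH := by
  show 0 < pp.re
  rw [pp_re]; positivity
lemma pp_exp : pp = Complex.exp ((Real.pi / 4 : ℝ) * I) := by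
  apply Complex.ext
  · rw [Complex.exp_ofReal_mul_I_re, Real.cos_pi_div_four, pp_re]
  · rw [Complex.exp_ofReal_mul_I_im, Real.sin_pi_div_four, pp_im]
lemma pp_sq : pp ^ 2 = I := by
  rw [pp_exp, ← Complex.exp_nat_mul]
  rw [show ((2:ℕ):ℂ) * ((Real.pi / 4 : ℝ) * I) = Real.pi / 2 * I by push_cast; ring]
  exact Complex.exp_pi_div_two_mul_I
lemma pp_cpow (γ : ℝ) : pp ^ (γ : ℂ) = ea γ := by
  rw [Complex.cpow_def_of_ne_zero (RH_ne pp_RH), pp_exp, Complex.log_exp, ea]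
  · congr 1; push_cast; ring
  · simp; linarith [Real.pi_pos]
  · simp; linarith [Real.pi_pos]

/-- spectral parameter -/
def lam (z : ℂ) : ℂ := -I * z ^ 2
lemma lam_pp : lam pp = 1 := by
  unfold lam; rw [pp_sq]; simp
lemma lam_sub (z : ℂ) : lam z - 1 = -I * ((z - pp) * (z + pp)) := by
  unfold lam
  have := pp_sq
  linear_combination -I * this - Complex.I_sq
lemma lam_ne {z : ℂ} (h : z ∈ RH) (h' : z ≠ pp) : lam z - 1 ≠ 0 := by
  rw [lam_sub]
  exact mul_ne_zero (by simp) (mul_ne_zero (sub_ne_zero.2 h') (RH_add h pp_RH))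
lemma lam_deriv (z : ℂ) : HasDerivAt lam (-I * (2 * z)) z := by
  unfold lam
  have := ((hasDerivAt_id z).pow 2).const_mul (-I)
  simpa using this
lemma lam_diff : Differentiable ℂ lam := fun z => (lam_deriv z).differentiableAt

lemma div_lam {g : ℂ → ℂ} (hg : DifferentiableOn ℂ g RH) (h0 : g pp = 0) :
    ∃ h : ℂ → ℂ, DifferentiableOn ℂ h RH ∧ ∀ z ∈ RH, (lam z - 1) * h z = g z := by
  have hd : DifferentiableOn ℂ (dslope g pp) RH :=
    (Complex.differentiableOn_dslope (RH_open.mem_nhds pp_RH)).2 hg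
  refine ⟨fun z => dslope g pp z / (-I * (z + pp)), hd.div (by fun_prop) ?_, ?_⟩
  · intro z hz
    exact mul_ne_zero (by simp) (RH_add hz pp_RH)
  · intro z hz
    have h1 := sub_smul_dslope g pp z
    rw [smul_eq_mul, h0, sub_zero] at h1
    have h2 := RH_add hz pp_RH
    rw [lam_sub, ← h1]
    have : I ≠ 0 := Complex.I_ne_zero
    field_simp

/-- the first order system satisfied by the axis vectors -/
structure AxP (s c g u : ℂ) (E : (ℂ → ℂ) × (ℂ → ℂ)) : Prop where
  d1 : DifferentiableOn ℂ E.1 RH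
  d2 : DifferentiableOn ℂ E.2 RH
  o1 : ∀ z ∈ RH, z * (lam z - 1) * deriv E.1 z = 2 * c * (-lam z * E.1 z + u * E.2 z)
  o2 : ∀ z ∈ RH, z * (lam z - 1) * deriv E.2 z =
    2 * ((s - g) / u * lam z * E.1 z + (g * lam z - s) * E.2 z)
  l : E.1 pp = u * E.2 pp
  n : E.2 pp ≠ 0

def AxL (u : ℂ) (E G : (ℂ → ℂ) × (ℂ → ℂ)) : Prop :=
  ∀ z ∈ RH, (lam z - 1) * G.1 z = E.1 z - u * E.2 z ∧
    (lam z - 1) * G.2 z = - (lam z / u) * E.1 z + E.2 z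

lemma AxP.step {s c g u u' : ℂ} {E : (ℂ → ℂ) × (ℂ → ℂ)} (h : AxP s c g u E)
    (hu : u ≠ 0) (hu' : u' ≠ 0) (huu : (1 - g) * u' = (c + s) * u) (hg : 1 - g ≠ 0) :
    ∃ G, AxP s (1 - g) (-c) u' G ∧ AxL u E G := by
  obtain ⟨G1, dG1, hG1⟩ := div_lam (g := fun z => E.1 z - u * E.2 z)
    (h.d1.sub (h.d2.const_mul u)) (by simp [h.l])
  obtain ⟨G2, dG2, hG2⟩ := div_lam (g := fun z => - (lam z / u) * E.1 z + E.2 z)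
    (((((lam_diff.div_const u).neg).differentiableOn).mul h.d1).add h.d2) (by
      simp [lam_pp, h.l, hu])
  have hL : AxL u E (G1, G2) := fun z hz => ⟨hG1 z hz, hG2 z hz⟩
  have hfin : ({pp} : Set ℂ).Finite := Set.finite_singleton _
  have cl : ContinuousOn lam RH := lam_diff.continuous.continuousOn
  have cE1 := h.d1.continuousOn
  have cE2 := h.d2.continuousOn
  have cG1 := dG1.continuousOn
  have cG2 := dG2.continuousOn
  have cG1' : ContinuousOn (deriv G1) RH := (dG1.deriv RH_open).continuousOn
  have cG2' : ContinuousOn (deriv G2) RH := (dG2.deriv RH_open).continuousOn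
  have inv1 : ∀ z ∈ RH, E.1 z = -(G1 z + u * G2 z) := by
    apply ext_off hfin cE1 (by fun_prop)
    intro z hz hzp
    apply mul_left_cancel₀ (lam_ne hz hzp)
    have a := hG1 z hz
    have b := hG2 z hz
    field_simp at b
    linear_combination a + b
  have inv2 : ∀ z ∈ RH, E.2 z = -(lam z / u * G1 z + G2 z) := by
    apply ext_off hfin cE2 (by fun_prop)
    intro z hz hzp
    apply mul_left_cancel₀ (lam_ne hz hzp)
    have a := hG1 z hz
    have b := hG2 z hz
    field_simp at b ⊢
    linear_combination a * lam z + b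
  have dz : ∀ z ∈ RH, ((lam z - 1) * deriv G1 z + (-I * (2 * z)) * G1 z
      = deriv E.1 z - u * deriv E.2 z) ∧
      ((lam z - 1) * deriv G2 z + (-I * (2 * z)) * G2 z
      = - (lam z / u) * deriv E.1 z - (-I * (2*z) / u) * E.1 z + deriv E.2 z) := by
    intro z hz
    have hn : RH ∈ nhds z := RH_open.mem_nhds hz
    have e1 := (h.d1.differentiableAt hn).hasDerivAt
    have e2 := (h.d2.differentiableAt hn).hasDerivAt
    have g1 := (dG1.differentiableAt hn).hasDerivAt
    have g2 := (dG2.differentiableAt hn).hasDerivAt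
    constructor
    · have a := ((lam_deriv z).sub_const 1).mul g1
      have b := e1.sub (e2.const_mul u)
      have : (fun z => (lam z - 1)) * G1 =ᶠ[nhds z] E.1 - (fun z => u * E.2 z) := by
        filter_upwards [hn] with x hx
        simpa using hG1 x hx
      have := (a.congr_of_eventuallyEq this.symm).unique b
      linear_combination this
    · have a := ((lam_deriv z).sub_const 1).mul g2
      have b := ((((lam_deriv z).div_const u).neg).mul e1).add e2
      have : (fun z => (lam z - 1)) * G2 =ᶠ[nhds z] (-(fun z => lam z / u)) * E.1 + E.2 := by
        filter_upwards [hn] with x hx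
        simpa using hG2 x hx
      have := (a.congr_of_eventuallyEq this.symm).unique b
      simp only [Pi.neg_apply] at this
      linear_combination this
  have o1 : ∀ z ∈ RH, z * (lam z - 1) * deriv G1 z =
      2 * (1 - g) * (-lam z * G1 z + u' * G2 z) := by
    apply ext_off hfin (by fun_prop) (by fun_prop)
    intro z hz hzp
    apply mul_left_cancel₀ (lam_ne hz hzp)
    have a := (dz z hz).1
    have b := h.o1 z hz
    have d := h.o2 z hz
    have zl : -I * (2 * z) * z = 2 * lam z := by unfold lam; ring
    rw [inv1 z hz, inv2 z hz] at b d
    field_simp at b d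
    generalize lam z = L at *
    linear_combination z * (L - 1) * a - (L - 1) * G1 z * zl + b - d - 2*(L-1)*G2 z * huu
  have o2 : ∀ z ∈ RH, z * (lam z - 1) * deriv G2 z =
      2 * ((s - -c) / u' * lam z * G1 z + (-c * lam z - s) * G2 z) := by
    apply ext_off hfin (by fun_prop) (by fun_prop)
    intro z hz hzp
    apply mul_left_cancel₀ (lam_ne hz hzp)
    have a := (dz z hz).2
    have b := h.o1 z hz
    have d := h.o2 z hz
    have zl : -I * (2 * z) * z = 2 * lam z := by unfold lam; ring
    have hcs : (s - -c) / u' = (1 - g) / u := by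
      rw [div_eq_div_iff hu' hu]; linear_combination -huu
    rw [hcs]
    rw [inv1 z hz, inv2 z hz] at b d
    rw [inv1 z hz] at a
    generalize lam z = L at *
    apply mul_left_cancel₀ hu
    field_simp at a b d ⊢
    linear_combination z * (L - 1) * a - (L - 1) * (u * G2 z - (G1 z + u * G2 z)) * zl - L * b + d
  have l : G1 pp = u' * G2 pp := by
    have := o1 pp pp_RH
    rw [lam_pp] at this
    have h3 : (1 - g) * (G1 pp - u' * G2 pp) = 0 := by linear_combination this / 2
    rcases mul_eq_zero.1 h3 with h4 | h4
    · exact absurd h4 hg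
    · linear_combination h4
  refine ⟨(G1, G2), ⟨dG1, dG2, o1, o2, l, ?_⟩, hL⟩
  intro h0
  have h0' : G2 pp = 0 := h0
  apply h.n
  rw [inv2 pp pp_RH, l, h0']; simp

/-- coefficient in the axis system -/
def cc (γ : ℝ) (n : ℕ) : ℝ := if Even n then (n:ℝ)/2 else ((n:ℝ) + 1 - γ)/2

lemma cc_succ2 (γ : ℝ) (n : ℕ) : cc γ (n+2) = 1 + cc γ n := by
  unfold cc
  have : Even (n+2) ↔ Even n := by rw [Nat.even_add]; simp
  simp only [this]
  split_ifs <;> push_cast <;> ring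

lemma cc_pos {γ : ℝ} (h2 : γ < 2) (n : ℕ) : 0 < cc γ (n+1) := by
  unfold cc
  have hn : (0:ℝ) ≤ n := Nat.cast_nonneg n
  split_ifs <;> push_cast <;> linarith

lemma exists_chain {α : Type*} (P : ℕ → α → Prop) (L : ℕ → α → α → Prop) (x0 : α) (h0 : P 0 x0)
    (h : ∀ n x, P n x → ∃ y, P (n+1) y ∧ L n x y) :
    ∃ s : ℕ → α, s 0 = x0 ∧ ∀ n, P n (s n) ∧ L n (s n) (s (n+1)) := by
  choose! g hg using h
  let s : ℕ → α := fun n => Nat.rec x0 (fun n x => g n x) n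
  have hs : ∀ n, P n (s n) := by
    intro n
    induction n with
    | zero => exact h0
    | succ n ih => exact (hg n _ ih).1
  exact ⟨s, rfl, fun n => ⟨hs n, (hg n _ (hs n)).2⟩⟩

namespace ZSetup
variable {γ : ℝ} {f : ℕ → ℕ → ℂ}

lemma ax_cc (H : ZSetup γ f) (n : ℕ) : (γ:ℂ) * f n 0 = 2 * (cc γ n : ℂ) * (UU γ n : ℂ) := by
  rw [(H.ax n).2]
  congr 1
  unfold cc
  split_ifs <;> push_cast <;> ring

lemma UU_rel (H : ZSetup γ f) (n : ℕ) :
    cc γ (n+1) * UU γ (n+1) = (cc γ n + γ/2) * UU γ n := by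
  have h1 := H.ax_cc n
  have h2 := H.ax_cc (n+1)
  have h3 := (H.ax n).1
  unfold uu at h3
  have : ((cc γ (n+1) * UU γ (n+1) : ℝ) : ℂ) = (((cc γ n + γ/2) * UU γ n : ℝ) : ℂ) := by
    push_cast
    rw [← h3] at h1 ⊢
    linear_combination (h1 - h2) / 2
  exact_mod_cast this

lemma axE (H : ZSetup γ f) : ∃ E : ℕ → (ℂ → ℂ) × (ℂ → ℂ),
    E 0 = (fun _ => 1, fun z => (starRingEnd ℂ) (ea γ) * z ^ (γ:ℂ)) ∧
    ∀ n, AxP (γ/2) (cc γ n) (1 - cc γ (n+1)) (UU γ n) (E n) ∧ AxL (UU γ n) (E n) (E (n+1)) := by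
  have hU : ∀ n, (UU γ n : ℂ) ≠ 0 := fun n => by exact_mod_cast (UU_pos H.h0 H.h2 n).ne'
  refine exists_chain (fun n E => AxP (γ/2) (cc γ n) (1 - cc γ (n+1)) (UU γ n) E)
    (fun n E G => AxL (UU γ n) E G) _ ?_ ?_
  · have hd : ∀ z ∈ RH, HasDerivAt (fun z : ℂ => (starRingEnd ℂ) (ea γ) * z ^ (γ:ℂ))
        ((starRingEnd ℂ) (ea γ) * (γ * z ^ ((γ:ℂ) - 1))) z := by
      intro z hz
      have := (hasDerivAt_id z).cpow_const (c := (γ:ℂ)) (Or.inl hz)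
      simpa using this.const_mul ((starRingEnd ℂ) (ea γ))
    have hc0 : cc γ 0 = 0 := by simp [cc]
    have hc1 : cc γ 1 = (2 - γ)/2 := by simp [cc]; ring
    have hpp : (starRingEnd ℂ) (ea γ) * pp ^ (γ:ℂ) = 1 := by
      rw [pp_cpow, mul_comm, ea_conj]
    refine ⟨by fun_prop, fun z hz => (hd z hz).differentiableAt.differentiableWithinAt, ?_, ?_, ?_, ?_⟩
    · intro z hz; simp [hc0]
    · intro z hz
      simp only
      rw [(hd z hz).deriv, Complex.cpow_sub _ _ (RH_ne hz), Complex.cpow_one, hc1]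
      have := RH_ne hz
      push_cast
      field_simp
      ring
    · simp only; rw [hpp]; simp [UU]
    · simp only; rw [hpp]; simp
  · intro n E h
    have hcp : (cc γ (n+1) : ℂ) ≠ 0 := by exact_mod_cast (cc_pos H.h2 n).ne'
    have hr : ((cc γ (n+1) * UU γ (n+1) : ℝ) : ℂ) = (((cc γ n + γ/2) * UU γ n : ℝ) : ℂ) := by
      rw [H.UU_rel]
    push_cast at hr
    obtain ⟨G, hG, hL⟩ := h.step (u' := UU γ (n+1)) (hU n) (hU (n+1))
      (by rw [← hr]; ring) (by simpa using hcp)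
    refine ⟨G, ?_, hL⟩
    have e1 : (1 - (1 - (cc γ (n+1) : ℂ))) = cc γ (n+1) := by ring
    have e2 : (1 - (cc γ (n+1+1) : ℂ)) = - cc γ n := by
      rw [show n+1+1 = n+2 from rfl, cc_succ2]; push_cast; ring
    rw [e1] at hG
    simp only [e2]
    exact hG

/-- the lattice of Lax vectors -/
structure Lax (γ : ℝ) (f : ℕ → ℕ → ℂ) (E1 E2 : ℕ → ℕ → ℂ → ℂ) : Prop where
  i1 : ∀ z, E1 0 0 z = 1
  i2 : ∀ z, E2 0 0 z = (starRingEnd ℂ) (ea γ) * z ^ (γ:ℂ)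
  d1 : ∀ n m, DifferentiableOn ℂ (E1 n m) RH
  d2 : ∀ n m, DifferentiableOn ℂ (E2 n m) RH
  h1 : ∀ n m, ∀ z ∈ RH, (lam z - 1) * E1 (n+1) m z = E1 n m z - uu f n m * E2 n m z
  h2 : ∀ n m, ∀ z ∈ RH, (lam z - 1) * E2 (n+1) m z = -(lam z / uu f n m) * E1 n m z + E2 n m z
  v1 : ∀ n m, ∀ z, E1 n (m+1) z = E1 n m z - vv f n m * E2 n m z
  v2 : ∀ n m, ∀ z, E2 n (m+1) z = lam z / vv f n m * E1 n m z + E2 n m z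
  p : ∀ n m, E1 n m pp = uu f n m * E2 n m pp
  pn : ∀ n m, E2 n m pp ≠ 0

def EL (f : ℕ → ℕ → ℂ) (E : ℕ → (ℂ → ℂ) × (ℂ → ℂ)) (n : ℕ) : ℕ → (ℂ → ℂ) × (ℂ → ℂ)
  | 0 => E n
  | (m+1) => (fun z => (EL f E n m).1 z - vv f n m * (EL f E n m).2 z,
      fun z => lam z / vv f n m * (EL f E n m).1 z + (EL f E n m).2 z)

lemma lax (H : ZSetup γ f) : ∃ E1 E2, Lax γ f E1 E2 := by
  obtain ⟨E, hE0, hE⟩ := H.axE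
  have hd : ∀ n m, DifferentiableOn ℂ (EL f E n m).1 RH ∧ DifferentiableOn ℂ (EL f E n m).2 RH := by
    intro n m
    induction m with
    | zero => exact ⟨(hE n).1.d1, (hE n).1.d2⟩
    | succ m ih =>
      have := lam_diff.differentiableOn (s := RH)
      obtain ⟨i1, i2⟩ := ih
      constructor
      · simp only [EL]; fun_prop
      · simp only [EL]; fun_prop
  have hh : ∀ m n, ∀ z ∈ RH, (lam z - 1) * (EL f E (n+1) m).1 z
        = (EL f E n m).1 z - uu f n m * (EL f E n m).2 z ∧
      (lam z - 1) * (EL f E (n+1) m).2 z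
        = -(lam z / uu f n m) * (EL f E n m).1 z + (EL f E n m).2 z := by
    intro m
    induction m with
    | zero =>
      intro n z hz
      rw [(H.ax n).1]
      exact (hE n).2 z hz
    | succ m ih =>
      intro n z hz
      obtain ⟨a1, a2⟩ := ih n z hz
      simp only [EL]
      have hu := uu_ne H.q n m
      have hv := vv_ne H.q n m
      have hu' := uu_ne H.q n (m+1)
      have hv' := vv_ne H.q (n+1) m
      have q1 := q_mul H.q n m
      have q2 := uv_close f n m
      have q3 := q_v H.q n m
      generalize (EL f E n m).1 z = e1 at *
      generalize (EL f E n m).2 z = e2 at *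
      generalize (EL f E (n+1) m).1 z = g1 at *
      generalize (EL f E (n+1) m).2 z = g2 at *
      generalize lam z = L at *
      have i1 : 1 / uu f n (m+1) = - uu f n m / (vv f n m * vv f (n+1) m) := by
        rw [div_eq_div_iff hu' (mul_ne_zero hv hv')]; linear_combination q1
      have i2 : L / uu f n (m+1) = L * (- uu f n m / (vv f n m * vv f (n+1) m)) := by
        rw [← i1]; ring
      rw [i2]
      generalize uu f n m = u at *
      generalize uu f n (m+1) = u' at *
      generalize vv f n m = v at *
      generalize vv f (n+1) m = v' at *
      have e_u' : u' = -(v * v') / u := by field_simp; linear_combination q1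
      constructor
      · rw [show (L-1) * (g1 - v' * g2) = (L-1)*g1 - v' * ((L-1)*g2) by ring, a1, a2]
        have : (v'/u + u'/v) = 0 := by field_simp; linear_combination q1
        linear_combination L * e1 * this - e2 * q2
      · rw [show (L-1) * (L / v' * g1 + g2) = L / v' * ((L-1)*g1) + (L-1)*g2 by ring, a1, a2]
        field_simp
        linear_combination (-e1 * L) * q3
  have hn : ∀ n m, (EL f E n m).2 pp ≠ 0 := by
    intro n m
    induction m with
    | zero => exact (hE n).1.n
    | succ m ih =>
      intro h0
      apply ih
      have a := (hh (m+1) n pp pp_RH).1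
      rw [lam_pp, h0] at a
      have b : (EL f E n (m+1)).1 pp = 0 := by linear_combination -a
      simp only [EL, lam_pp] at h0 b
      have hv := vv_ne H.q n m
      field_simp at h0
      have : 2 * vv f n m * (EL f E n m).2 pp = 0 := by linear_combination h0 - b
      simpa [hv] using this
  refine ⟨fun n m => (EL f E n m).1, fun n m => (EL f E n m).2, ?_, ?_, fun n m => (hd n m).1,
    fun n m => (hd n m).2, fun n m z hz => (hh m n z hz).1, fun n m z hz => (hh m n z hz).2,
    fun n m z => rfl, fun n m z => rfl, ?_, hn⟩
  · intro z; simp [EL, hE0]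
  · intro z; simp [EL, hE0]
  · intro n m
    have a := (hh m n pp pp_RH).1
    rw [lam_pp] at a
    linear_combination -a

end ZSetup

lemma conj_RH {a : ℂ} (h : a ∈ RH) : (starRingEnd ℂ) a ∈ RH := by
  simpa [RH] using h

lemma schwarz_RH {φ : ℂ → ℂ} {a : ℂ} (ha : a ∈ RH) (hd : DifferentiableOn ℂ φ RH)
    (hb : ∀ z ∈ RH, ‖φ z‖ ≤ 1) (h0 : φ a = 0) {z : ℂ} (hz : z ∈ RH) :
    ‖φ z‖ ≤ ‖(z - a) / (z + (starRingEnd ℂ) a)‖ := by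
  have har : 0 < a.re := ha
  have hzr : 0 < z.re := hz
  have hza := RH_add hz (conj_RH ha)
  set g : ℂ → ℂ := fun w => φ ((a + (starRingEnd ℂ) a * w) / (1 - w)) with hg
  have hne : ∀ w ∈ Metric.ball (0:ℂ) 1, 1 - w ≠ 0 := by
    intro w hw h
    have : w = 1 := by linear_combination -h
    rw [this] at hw; simp at hw
  have hmap : ∀ w ∈ Metric.ball (0:ℂ) 1, (a + (starRingEnd ℂ) a * w) / (1 - w) ∈ RH := by
    intro w hw
    have h1 := hne w hw
    have h2 : Complex.normSq w < 1 := by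
      rw [Complex.normSq_eq_norm_sq]
      rw [mem_ball_zero_iff] at hw
      nlinarith [norm_nonneg w]
    show 0 < Complex.re _
    rw [Complex.div_re, ← add_div]
    apply div_pos
    · simp only [Complex.add_re, Complex.add_im, Complex.mul_re, Complex.mul_im, Complex.conj_re,
        Complex.conj_im, Complex.sub_re, Complex.sub_im, Complex.one_re, Complex.one_im]
      rw [Complex.normSq_apply] at h2
      nlinarith [mul_pos har (sub_pos.2 h2)]
    · exact Complex.normSq_pos.2 h1
  have hgd : DifferentiableOn ℂ g (Metric.ball 0 1) := by
    apply DifferentiableOn.comp hd _ hmap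
    apply DifferentiableOn.div (by fun_prop) (by fun_prop) hne
  have hgm : Set.MapsTo g (Metric.ball 0 1) (Metric.closedBall 0 1) := by
    intro w hw
    rw [mem_closedBall_zero_iff]
    exact hb _ (hmap w hw)
  have hg0 : g 0 = 0 := by simp [hg, h0]
  have hw : ‖(z - a) / (z + (starRingEnd ℂ) a)‖ < 1 := by
    rw [norm_div, div_lt_one (norm_pos_iff.2 hza)]
    rw [Complex.norm_def, Complex.norm_def]
    apply Real.sqrt_lt_sqrt (Complex.normSq_nonneg _)
    rw [Complex.normSq_apply, Complex.normSq_apply]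
    simp
    nlinarith [mul_pos har hzr]
  have := Complex.norm_le_norm_of_mapsTo_ball hgd hgm hg0 hw
  suffices e : g ((z - a) / (z + (starRingEnd ℂ) a)) = φ z by rwa [e] at this
  show φ _ = φ z
  congr 1
  have e1 : 1 - (z - a) / (z + (starRingEnd ℂ) a) = (a + (starRingEnd ℂ) a) / (z + (starRingEnd ℂ) a) := by
    field_simp; ring
  have e2 : a + (starRingEnd ℂ) a ≠ 0 := RH_add ha (conj_RH ha)
  rw [e1]
  field_simp
  ring

lemma factor_RH {φ : ℂ → ℂ} {a : ℂ} (ha : a ∈ RH) (hd : DifferentiableOn ℂ φ RH)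
    (hb : ∀ z ∈ RH, ‖φ z‖ ≤ 1) (h0 : φ a = 0) : ∃ ψ : ℂ → ℂ, DifferentiableOn ℂ ψ RH ∧
      (∀ z ∈ RH, ‖ψ z‖ ≤ 1) ∧ ∀ z ∈ RH, φ z * (z + (starRingEnd ℂ) a) = (z - a) * ψ z := by
  have hds : DifferentiableOn ℂ (dslope φ a) RH :=
    (Complex.differentiableOn_dslope (RH_open.mem_nhds ha)).2 hd
  have hid : ∀ z, (z - a) * dslope φ a z = φ z := by
    intro z
    have h1 := sub_smul_dslope φ a z
    rwa [smul_eq_mul, h0, sub_zero] at h1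
  have hψd : DifferentiableOn ℂ (fun z => dslope φ a z * (z + (starRingEnd ℂ) a)) RH :=
    hds.mul (by fun_prop)
  refine ⟨fun z => dslope φ a z * (z + (starRingEnd ℂ) a), hψd, ?_, ?_⟩
  · have key : ∀ z ∈ RH, z ≠ a → ‖dslope φ a z * (z + (starRingEnd ℂ) a)‖ ≤ 1 := by
      intro z hz hza
      have h1 := schwarz_RH ha hd hb h0 hz
      rw [norm_div, le_div_iff₀ (norm_pos_iff.2 (RH_add hz (conj_RH ha))), ← hid z, norm_mul,
        mul_assoc] at h1
      rw [norm_mul]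
      have : 0 < ‖z - a‖ := norm_pos_iff.2 (sub_ne_zero.2 hza)
      by_contra hcon
      push Not at hcon
      nlinarith
    intro z hz
    by_cases hza : z = a
    · subst hza
      have hn := RH_open.mem_nhds hz
      have hc := (hψd.continuousOn.continuousAt hn).norm.tendsto
      have hc' := hc.mono_left (nhdsWithin_le_nhds (s := {z}ᶜ))
      apply le_of_tendsto hc'
      filter_upwards [mem_nhdsWithin_of_mem_nhds hn, self_mem_nhdsWithin] with x hx hx2
      exact key x hx hx2
    · exact key z hz hza
  · intro z hz
    rw [← hid z]; ring

lemma factor2_RH {φ : ℂ → ℂ} (hd : DifferentiableOn ℂ φ RH)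
    (hb : ∀ z ∈ RH, ‖φ z‖ ≤ 1) (h0 : φ pp = 0) (h1 : φ ((starRingEnd ℂ) pp) = 0) :
    ∃ ψ : ℂ → ℂ, DifferentiableOn ℂ ψ RH ∧
      (∀ z ∈ RH, ‖ψ z‖ ≤ 1) ∧ ∀ z ∈ RH,
        φ z * (z^2 + √2 * z + 1) = (z^2 - √2 * z + 1) * ψ z := by
  have e0 : pp + (starRingEnd ℂ) pp = √2 := by
    rw [Complex.add_conj, pp_re]; push_cast; ring
  have e1 : pp * (starRingEnd ℂ) pp = 1 := by
    rw [Complex.mul_conj, Complex.normSq_apply, pp_re, pp_im]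
    have : (√2)^2 = 2 := Real.sq_sqrt (by norm_num)
    norm_cast; nlinarith
  obtain ⟨ψ, a1, a2, a3⟩ := factor_RH pp_RH hd hb h0
  have hz : ψ ((starRingEnd ℂ) pp) = 0 := by
    have := a3 _ (conj_RH pp_RH)
    rw [h1, zero_mul] at this
    rcases mul_eq_zero.1 this.symm with h | h
    · have h2 := congrArg Complex.im h
      simp [pp_im] at h2
      have : 0 < √2 := by positivity
      linarith
    · exact h
  obtain ⟨χ, b1, b2, b3⟩ := factor_RH (conj_RH pp_RH) a1 a2 hz
  refine ⟨χ, b1, b2, ?_⟩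
  intro z hz
  have c1 := a3 z hz
  have c2 := b3 z hz
  rw [Complex.conj_conj] at c2
  linear_combination (z + pp) * c1 + (z - pp) * c2 - (φ z * z - χ z * (-z)) * e0 - (φ z - χ z) * e1

/-- Schur function attached to a pair -/
structure DR (ρ a b : ℂ → ℂ) : Prop where
  d : DifferentiableOn ℂ ρ RH
  bd : ∀ z ∈ RH, ‖ρ z‖ ≤ 1
  s : ∀ z ∈ RH, ρ ((starRingEnd ℂ) z) = (starRingEnd ℂ) (ρ z)
  i : ∀ z ∈ RH, ρ z * (z - 1) * (a z + b z) = (z + 1) * (a z - b z)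

lemma mob_ne {t : ℝ} (ht : |t| < 1) {x : ℂ} (hx : ‖x‖ ≤ 1) : 1 + t * x ≠ 0 := by
  intro h
  have h1 : ‖(t:ℂ) * x‖ = 1 := by
    rw [show (t:ℂ) * x = -1 by linear_combination h]; simp
  rw [norm_mul, Complex.norm_real, Real.norm_eq_abs] at h1
  nlinarith [norm_nonneg x, abs_nonneg t]

lemma mob_le {t : ℝ} (ht : |t| < 1) {x : ℂ} (hx : ‖x‖ ≤ 1) : ‖(x + t) / (1 + t * x)‖ ≤ 1 := by
  have h := mob_ne ht hx
  rw [norm_div, div_le_one (norm_pos_iff.2 h), Complex.norm_def, Complex.norm_def]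
  apply Real.sqrt_le_sqrt
  have h1 : Complex.normSq x ≤ 1 := by
    rw [Complex.normSq_eq_norm_sq]; nlinarith [norm_nonneg x]
  have h2 : t^2 < 1 := by rw [sq_lt_one_iff_abs_lt_one]; exact ht
  rw [Complex.normSq_apply] at *
  rw [Complex.normSq_apply]
  simp
  nlinarith [mul_nonneg (sub_nonneg.2 h1) (sub_pos.2 h2).le]

lemma continuousOn_conj {g : ℂ → ℂ} (hg : ContinuousOn g RH) :
    ContinuousOn (fun z => (starRingEnd ℂ) (g ((starRingEnd ℂ) z))) RH := by
  apply Complex.continuous_conj.comp_continuousOn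
  exact hg.comp Complex.continuous_conj.continuousOn (fun z hz => conj_RH hz)

lemma sqrt2_sq : (√2)^2 = 2 := Real.sq_sqrt (by norm_num)

lemma node_S {c σ : ℝ} {r : ℂ} (hr : ‖r‖ ≤ 1) (hcs : c^2 + σ^2 = 1)
    (h : r * (pp - 1) * (pp * (c - I * σ) + 1) = (pp + 1) * (pp * (c - I * σ) - 1)) :
    1 ≤ c + σ := by
  have h1 := congrArg Complex.normSq h
  rw [Complex.normSq_mul, Complex.normSq_mul, Complex.normSq_mul] at h1
  have hr' : Complex.normSq r ≤ 1 := by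
    rw [Complex.normSq_eq_norm_sq]; nlinarith [norm_nonneg r]
  have h2 := sqrt2_sq
  have e1 : Complex.normSq (pp - 1) = 2 - √2 := by
    rw [Complex.normSq_apply]; simp [pp_re, pp_im]; nlinarith
  have e2 : Complex.normSq (pp + 1) = 2 + √2 := by
    rw [Complex.normSq_apply]; simp [pp_re, pp_im]; nlinarith
  have e3 : Complex.normSq (pp * (c - I * σ) + 1) = 2 + √2 * (c + σ) := by
    rw [Complex.normSq_apply]; simp [pp_re, pp_im]
    linear_combination (c^2+σ^2)/2 * h2 + hcs
  have e4 : Complex.normSq (pp * (c - I * σ) - 1) = 2 - √2 * (c + σ) := by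
    rw [Complex.normSq_apply]; simp [pp_re, pp_im]
    linear_combination (c^2+σ^2)/2 * h2 + hcs
  have h3 : 0 < √2 := by positivity
  have h4 := Complex.normSq_nonneg (pp - 1)
  have h5 := Complex.normSq_nonneg (pp * (c - I * σ) + 1)
  rw [e1, e2, e3, e4] at h1
  rw [e1] at h4
  rw [e3] at h5
  have h6 : (2 + √2) * (2 - √2 * (c+σ)) ≤ (2 - √2) * (2 + √2 * (c+σ)) := by
    rw [← h1, mul_assoc]
    have := mul_nonneg h4 h5
    nlinarith [mul_nonneg (sub_nonneg.2 hr') this]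
  by_contra hcon
  push Not at hcon
  nlinarith [mul_pos h3 (sub_pos.2 hcon)]

lemma rho_node {c σ : ℝ} (hc : 0 < c) (hσ : 0 < σ) {r : ℂ} (hcs : c^2 + σ^2 = 1)
    (hN : 0 < √2 * c + 1 + (σ - c))
    (h : r * (pp - 1) * (pp * (c - I * σ) + 1) = (pp + 1) * (pp * (c - I * σ) - 1)) :
    r = ((√2 * c - 1 - (σ - c)) / (√2 * c + 1 + (σ - c)) : ℝ) := by
  have h2 := sqrt2_sq
  have h3 : 0 < √2 := by positivity
  have n1 : pp - 1 ≠ 0 := by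
    intro h; have := congrArg Complex.im h; simp [pp_im] at this
  have n2 : pp * (c - I * σ) + 1 ≠ 0 := by
    intro h; have := congrArg Complex.re h; simp [pp_re, pp_im] at this
    have : 0 < √2 / 2 * c + √2 / 2 * σ := by positivity
    linarith
  have hNc : ((√2 * c + 1 + (σ - c) : ℝ) : ℂ) ≠ 0 := by exact_mod_cast hN.ne'
  have key : ((√2 * c - 1 - (σ - c) : ℝ) : ℂ) * ((pp - 1) * (pp * (c - I * σ) + 1)) =
      ((√2 * c + 1 + (σ - c) : ℝ) : ℂ) * ((pp + 1) * (pp * (c - I * σ) - 1)) := by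
    apply Complex.ext
    · simp [pp_re, pp_im]
      ring_nf
      have h4 : σ^2 = 1 - c^2 := by linarith
      have h5 : (√2)^3 = 2 * √2 := by rw [pow_succ, h2]
      simp only [h2, h4, h5]
      ring_nf
    · simp [pp_re, pp_im]
      ring_nf
  rw [Complex.ofReal_div, eq_div_iff hNc]
  apply mul_right_cancel₀ (mul_ne_zero n1 n2)
  linear_combination ((√2 * c + 1 + (σ - c) : ℝ) : ℂ) * h - key

lemma coef_id {c σ s x y : ℝ} (hcs : c^2 + σ^2 = 1) (hs : s^2 = 2)
    (hN : s * c + 1 + (σ - c) ≠ 0) (hM : s * σ + 1 + (σ - c) ≠ 0)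
    (hx : x = (s * c - 1 - (σ - c)) / (s * c + 1 + (σ - c)))
    (hy : y = (s * σ - 1 - (σ - c)) / (s * σ + 1 + (σ - c))) :
    (c + σ) * (1 + y * x) = s * (1 - y * x) ∧ (σ - c) * (1 + y * x) = s * (y - x) ∧
      y + x = -(σ - c) * (1 + y * x) := by
  have hx' : x * (s * c + 1 + (σ - c)) = s * c - 1 - (σ - c) := by rw [hx]; field_simp
  have hy' : y * (s * σ + 1 + (σ - c)) = s * σ - 1 - (σ - c) := by rw [hy]; field_simp
  have h4 : σ^2 = 1 - c^2 := by linarith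
  have h5 : s^3 = 2 * s := by rw [pow_succ, hs]
  have h6 : σ^3 = (1 - c^2) * σ := by rw [pow_succ, h4]
  have hNM := mul_ne_zero hN hM
  have k1 : (s * c + 1 + (σ - c)) * (s * σ + 1 + (σ - c)) * (y * x) =
      (s * c - 1 - (σ - c)) * (s * σ - 1 - (σ - c)) := by rw [← hx', ← hy']; ring
  have k2 : (s * c + 1 + (σ - c)) * (s * σ + 1 + (σ - c)) * x =
      (s * c - 1 - (σ - c)) * (s * σ + 1 + (σ - c)) := by rw [← hx']; ring
  have k3 : (s * c + 1 + (σ - c)) * (s * σ + 1 + (σ - c)) * y =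
      (s * c + 1 + (σ - c)) * (s * σ - 1 - (σ - c)) := by rw [← hy']; ring
  refine ⟨?_, ?_, ?_⟩
  · apply mul_left_cancel₀ hNM
    have : (c + σ) * ((s * c + 1 + (σ - c)) * (s * σ + 1 + (σ - c)) + (s * c - 1 - (σ - c)) * (s * σ - 1 - (σ - c))) = s * ((s * c + 1 + (σ - c)) * (s * σ + 1 + (σ - c)) - (s * c - 1 - (σ - c)) * (s * σ - 1 - (σ - c))) := by
      ring_nf
      simp only [hs, h4, h5, h6]
      ring
    linear_combination this + (c + σ) * k1 + s * k1
  · apply mul_left_cancel₀ hNM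
    have : (σ - c) * ((s * c + 1 + (σ - c)) * (s * σ + 1 + (σ - c)) + (s * c - 1 - (σ - c)) * (s * σ - 1 - (σ - c))) = s * ((s * c + 1 + (σ - c)) * (s * σ - 1 - (σ - c)) - (s * c - 1 - (σ - c)) * (s * σ + 1 + (σ - c))) := by
      ring_nf
      simp only [hs, h4, h5, h6]
      ring
    linear_combination this + (σ - c) * k1 - s * k3 + s * k2
  · apply mul_left_cancel₀ hNM
    have : (s * c + 1 + (σ - c)) * (s * σ - 1 - (σ - c)) + (s * c - 1 - (σ - c)) * (s * σ + 1 + (σ - c)) = -(σ - c) * ((s * c + 1 + (σ - c)) * (s * σ + 1 + (σ - c)) + (s * c - 1 - (σ - c)) * (s * σ - 1 - (σ - c))) := by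
      ring_nf
      simp only [hs, h4, h5, h6]
      ring
    linear_combination this + (σ - c) * k1 + k3 + k2

lemma diag_pos {R R' c σ : ℝ} {a b ρ : ℂ → ℂ} (hR : 0 < R) (hR' : R' ≠ 0)
    (hcs : c^2 + σ^2 = 1) (hrel : c * R' = σ * R)
    (hp : a pp = pp * (c - I * σ) * b pp) (hbp : b pp ≠ 0) (hρ : DR ρ a b) :
    0 < c ∧ 0 < σ ∧
      ρ pp * (pp - 1) * (pp * (c - I * σ) + 1) = (pp + 1) * (pp * (c - I * σ) - 1) := by
  have h1 : ρ pp * (pp - 1) * (pp * (c - I * σ) + 1) = (pp + 1) * (pp * (c - I * σ) - 1) := by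
    have := hρ.i pp pp_RH
    rw [hp] at this
    apply mul_right_cancel₀ hbp
    linear_combination this
  have h2 := node_S (hρ.bd pp pp_RH) hcs h1
  have hσ0 : σ ≠ 0 := by
    rintro rfl
    have : c = 0 := by
      have : c * R' = 0 := by rw [hrel]; ring
      exact (mul_eq_zero.1 this).resolve_right hR'
    rw [this] at hcs; norm_num at hcs
  have hc0 : c ≠ 0 := by
    rintro rfl
    have : σ * R = 0 := by rw [← hrel]; ring
    exact hσ0 ((mul_eq_zero.1 this).resolve_right hR.ne')
  have h3 : 0 ≤ c * σ := by nlinarith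
  have h4 : 0 < c * σ := lt_of_le_of_ne h3 (mul_ne_zero hc0 hσ0).symm
  refine ⟨?_, ?_, h1⟩
  · by_contra hcon
    have : c < 0 := lt_of_le_of_ne (not_lt.1 hcon) hc0
    nlinarith
  · by_contra hcon
    have : σ < 0 := lt_of_le_of_ne (not_lt.1 hcon) hσ0
    nlinarith

lemma abs_frac {x y : ℝ} (hx : 0 < x) (hy : 0 < y) : |(x - y) / (x + y)| < 1 := by
  have : 0 < x + y := by positivity
  rw [abs_lt]
  constructor
  · rw [lt_div_iff₀ this]; linarith
  · rw [div_lt_iff₀ this]; linarith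

lemma Xm_ne {z : ℂ} (h1 : z ≠ pp) (h2 : z ≠ (starRingEnd ℂ) pp) : z^2 - √2 * z + 1 ≠ 0 := by
  have e0 : pp + (starRingEnd ℂ) pp = √2 := by
    rw [Complex.add_conj, pp_re]; push_cast; ring
  have e1 : pp * (starRingEnd ℂ) pp = 1 := by
    rw [Complex.mul_conj, Complex.normSq_apply, pp_re, pp_im]
    have : (√2)^2 = 2 := Real.sq_sqrt (by norm_num)
    norm_cast; nlinarith
  have : z^2 - √2 * z + 1 = (z - pp) * (z - (starRingEnd ℂ) pp) := by
    rw [← e0]; linear_combination -e1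
  rw [this]
  exact mul_ne_zero (sub_ne_zero.2 h1) (sub_ne_zero.2 h2)

lemma diag_step {c σ : ℝ} {a b a' b' ρ : ℂ → ℂ} (hc : 0 < c) (hσ : 0 < σ)
    (hcs : c^2 + σ^2 = 1) (hρ : DR ρ a b)
    (ha' : ContinuousOn a' RH) (hb' : ContinuousOn b' RH)
    (hnode : ρ pp * (pp - 1) * (pp * (c - I * σ) + 1) = (pp + 1) * (pp * (c - I * σ) - 1))
    (s1 : ∀ z ∈ RH, (lam z - 1) * c * a' z = (c + σ * z^2) * a z - z * b z)
    (s2 : ∀ z ∈ RH, (lam z - 1) * c * b' z = (σ + c * z^2) * b z - z * a z) :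
    ∃ ρ', DR ρ' a' b' := by
  have h3 : 0 < √2 := by positivity
  have hD : 0 < 1 + (σ - c) := by nlinarith
  have hN : 0 < √2 * c + 1 + (σ - c) := by nlinarith [mul_pos h3 hc]
  have hM : 0 < √2 * σ + 1 + (σ - c) := by nlinarith [mul_pos h3 hσ]
  have hr := rho_node hc hσ hcs hN hnode
  have hx1 : |(√2 * c - 1 - (σ - c)) / (√2 * c + 1 + (σ - c))| < 1 := by
    have := abs_frac (mul_pos h3 hc) hD
    rwa [← sub_sub, ← add_assoc] at this
  have hy1 : |(√2 * σ - 1 - (σ - c)) / (√2 * σ + 1 + (σ - c))| < 1 := by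
    have := abs_frac (mul_pos h3 hσ) hD
    rwa [← sub_sub, ← add_assoc] at this
  obtain ⟨x, hx⟩ : ∃ x, x = (√2 * c - 1 - (σ - c)) / (√2 * c + 1 + (σ - c)) := ⟨_, rfl⟩
  obtain ⟨y, hy⟩ : ∃ y, y = (√2 * σ - 1 - (σ - c)) / (√2 * σ + 1 + (σ - c)) := ⟨_, rfl⟩
  obtain ⟨k1, k2, k3⟩ := coef_id hcs sqrt2_sq hN.ne' hM.ne' hx hy
  rw [← hx] at hr hx1
  rw [← hy] at hy1
  have hx2 : |-x| < 1 := by rwa [abs_neg]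
  -- first Moebius
  set w : ℂ → ℂ := fun z => (ρ z + ((-x : ℝ):ℂ)) / (1 + ((-x : ℝ):ℂ) * ρ z) with hw
  have wne : ∀ z ∈ RH, 1 + ((-x : ℝ):ℂ) * ρ z ≠ 0 := fun z hz => mob_ne hx2 (hρ.bd z hz)
  have hρd := hρ.d
  have wd : DifferentiableOn ℂ w RH :=
    DifferentiableOn.div (by fun_prop) (by fun_prop) wne
  have wb : ∀ z ∈ RH, ‖w z‖ ≤ 1 := fun z hz => mob_le hx2 (hρ.bd z hz)
  have ws : ∀ z ∈ RH, w ((starRingEnd ℂ) z) = (starRingEnd ℂ) (w z) := by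
    intro z hz
    simp only [hw, hρ.s z hz, map_div₀, map_add, map_mul, map_one, Complex.conj_ofReal]
  have w0 : w pp = 0 := by simp only [hw]; rw [hr]; simp
  have w0' : w ((starRingEnd ℂ) pp) = 0 := by rw [ws pp pp_RH, w0, map_zero]
  obtain ⟨ψ, ψd, ψb, ψi⟩ := factor2_RH wd wb w0 w0'
  have ψc := ψd.continuousOn
  have ψs0 : ∀ z ∈ RH, ψ z = (starRingEnd ℂ) (ψ ((starRingEnd ℂ) z)) := by
    apply ext_off (S := {pp, (starRingEnd ℂ) pp}) (by simp) ψc (continuousOn_conj ψc)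
    intro z hz hzS
    have hz1 : z ≠ pp := fun h => hzS (by simp [h])
    have hz2 : z ≠ (starRingEnd ℂ) pp := fun h => hzS (by simp [h])
    apply mul_left_cancel₀ (Xm_ne hz1 hz2)
    rw [← ψi z hz]
    have := congrArg (starRingEnd ℂ) (ψi _ (conj_RH hz))
    simp only [map_mul, map_add, map_sub, map_pow, map_one, Complex.conj_conj,
      Complex.conj_ofReal, ws z hz] at this
    exact this
  have ψs : ∀ z ∈ RH, ψ ((starRingEnd ℂ) z) = (starRingEnd ℂ) (ψ z) := by
    intro z hz
    have := ψs0 _ (conj_RH hz)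
    rwa [Complex.conj_conj] at this
  have ψne : ∀ z ∈ RH, 1 + (y:ℂ) * ψ z ≠ 0 := fun z hz => mob_ne hy1 (ψb z hz)
  have rd : DifferentiableOn ℂ (fun z => (ψ z + y) / (1 + (y:ℂ) * ψ z)) RH :=
    DifferentiableOn.div (by fun_prop) (by fun_prop) ψne
  refine ⟨fun z => (ψ z + y) / (1 + (y:ℂ) * ψ z), rd, fun z hz => mob_le hy1 (ψb z hz), ?_, ?_⟩
  · intro z hz
    simp only [ψs z hz, map_div₀, map_add, map_mul, map_one, Complex.conj_ofReal]
  · have rc := rd.continuousOn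
    apply ext_off (S := {pp}) (by simp) (by fun_prop) (by fun_prop)
    intro z hz hzS
    have hzp : z ≠ pp := hzS
    have t1 : (ψ z + y) / (1 + (y:ℂ) * ψ z) * (1 + (y:ℂ) * ψ z) = ψ z + y :=
      div_mul_cancel₀ _ (ψne z hz)
    have t2 : w z * (1 - x * ρ z) = ρ z - x := by
      have := div_mul_cancel₀ (ρ z + ((-x : ℝ):ℂ)) (wne z hz)
      simp only [hw]
      push_cast at this ⊢
      linear_combination this
    have t2n : 1 - x * ρ z ≠ 0 := by
      have := wne z hz
      push_cast at this
      intro h; apply this; linear_combination h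
    have t3 := ψi z hz
    have hI := hρ.i z hz
    have S1 := s1 z hz
    have S2 := s2 z hz
    have hl := lam_ne hz hzp
    have hcc : (c:ℂ) ≠ 0 := by exact_mod_cast hc.ne'
    have hyx : (1 + y * x : ℝ) ≠ 0 := by
      have : |y * x| < 1 := by rw [abs_mul]; nlinarith [abs_nonneg x, abs_nonneg y]
      have := (abs_lt.1 this).1
      linarith
    have hyxc : (1 + y * x : ℂ) ≠ 0 := by exact_mod_cast hyx
    have hz1 : z + 1 ≠ 0 := RH_add hz (by simp [RH])
    have s2c : ((√2 : ℝ) : ℂ)^2 = 2 := by exact_mod_cast sqrt2_sq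
    have k1c : ((c:ℂ) + σ) * (1 + y * x) = (√2 : ℝ) * (1 - y * x) := by exact_mod_cast k1
    have k2c : ((σ:ℂ) - c) * (1 + y * x) = (√2 : ℝ) * (y - x) := by exact_mod_cast k2
    have k3c : (y:ℂ) + x = -(σ - c) * (1 + y * x) := by exact_mod_cast k3
    generalize (ψ z + y) / (1 + (y:ℂ) * ψ z) = r' at *
    generalize w z = W at *
    generalize ψ z = q at *
    generalize ρ z = r at *
    generalize ((√2 : ℝ) : ℂ) = s at *
    have hs0 : s ≠ 0 := by rintro rfl; norm_num at s2c
    -- main relation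
    have m1 : r' * ((z^2 - s * z + 1) * (1 - x * r) + y * (r - x) * (z^2 + s * z + 1)) =
        (r - x) * (z^2 + s * z + 1) + y * (1 - x * r) * (z^2 - s * z + 1) := by
      linear_combination (1 - x * r) * (z^2 - s*z+1) * t1 + (1 - (y:ℂ) * r') * (z^2 + s*z+1) * t2 - (1 - x * r) * (1 - (y:ℂ) * r') * t3
    have m2 : r' * ((c + σ) * (1 + z^2) - 2 * z + r * (σ - c) * (z - 1)^2) =
        (σ - c) * (z + 1)^2 + r * ((c + σ) * (1 + z^2) + 2 * z) := by
      apply mul_left_cancel₀ hyxc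
      have e1 : (1 + y * x) * ((c + σ) * (1 + z^2) - 2 * z + r * (σ - c) * (z - 1)^2) =
        s * ((z^2 - s * z + 1) * (1 - x * r) + y * (r - x) * (z^2 + s * z + 1)) := by
        linear_combination ((1 + z^2)) * k1c + r * (1 + z^2) * k2c + z * (1 + y * x) * s2c - 2 * r * z * k3c - r * z * (y + x) * s2c
      have e2 : (1 + y * x) * ((σ - c) * (z + 1)^2 + r * ((c + σ) * (1 + z^2) + 2 * z)) =
        s * ((r - x) * (z^2 + s * z + 1) + y * (1 - x * r) * (z^2 - s * z + 1)) := by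
        linear_combination (r * (1 + z^2)) * k1c + (1 + z^2) * k2c - r * z * (1 + y * x) * s2c + 2 * z * k3c + z * (y + x) * s2c
      linear_combination s * m1 + r' * e1 - e2
    apply mul_left_cancel₀ (mul_ne_zero (mul_ne_zero hl hcc) hz1)
    -- multiply out
    have f1 : (lam z - 1) * c * (a' z + b' z) = (a z + b z) / 2 * ((c + σ) * (1 + z^2) - 2 * z)
        + (a z - b z) / 2 * ((σ - c) * (z^2 - 1)) := by
      linear_combination S1 + S2
    have f2 : (lam z - 1) * c * (a' z - b' z) = (a z + b z) / 2 * ((σ - c) * (z^2 - 1))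
        + (a z - b z) / 2 * ((c + σ) * (1 + z^2) + 2 * z) := by
      linear_combination S1 - S2
    linear_combination (z + 1) * r' * (z - 1) * f1 - (z+1) * (z + 1) * f2 + (a z + b z) / 2 * (z + 1) * (z - 1) * m2 - (r' * (z-1) * (σ - c) * (z^2-1) / 2 - (z+1) * ((c+σ) * (1+z^2) + 2 * z)/2) * hI

lemma cpow_RH {z : ℂ} (hz : z ∈ RH) {t : ℝ} (ht : |t| < 1) : z ^ (t:ℂ) ∈ RH := by
  have h1 : |z.arg| < Real.pi / 2 := Complex.abs_arg_lt_pi_div_two_iff.2 (Or.inl hz)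
  show 0 < (z ^ (t:ℂ)).re
  rw [Complex.cpow_def_of_ne_zero (RH_ne hz), Complex.exp_re]
  apply mul_pos (Real.exp_pos _)
  have h2 : (Complex.log z * (t:ℂ)).im = z.arg * t := by
    simp [Complex.mul_im, Complex.log_im]
  rw [h2]
  have h3 : |z.arg * t| < Real.pi / 2 := by
    rw [abs_mul]
    nlinarith [abs_nonneg z.arg, abs_nonneg t, Real.pi_pos]
  exact Real.cos_pos_of_mem_Ioo ⟨(abs_lt.1 h3).1, (abs_lt.1 h3).2⟩

lemma cay_le {h : ℂ} (hh : h ∈ RH) : ‖(h - 1) / (h + 1)‖ ≤ 1 := by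
  have h1 : h + 1 ≠ 0 := RH_add hh (by simp [RH])
  rw [norm_div]
  apply div_le_one_of_le₀ _ (norm_nonneg _)
  rw [← sq_le_sq₀ (norm_nonneg _) (norm_nonneg _), ← Complex.normSq_eq_norm_sq,
    ← Complex.normSq_eq_norm_sq, Complex.normSq_apply, Complex.normSq_apply]
  have : 0 < h.re := hh
  simp; nlinarith

lemma conj_cpow_RH {z : ℂ} (hz : z ∈ RH) (t : ℝ) :
    ((starRingEnd ℂ) z) ^ (t:ℂ) = (starRingEnd ℂ) (z ^ (t:ℂ)) := by
  have hpi : z.arg ≠ Real.pi := by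
    have h1 : |z.arg| < Real.pi / 2 := Complex.abs_arg_lt_pi_div_two_iff.2 (Or.inl hz)
    intro h
    rw [h, abs_of_pos Real.pi_pos] at h1
    linarith [Real.pi_pos]
  rw [Complex.conj_cpow _ _ hpi, Complex.conj_ofReal]

lemma DR_base {γ : ℝ} (h0 : 0 < γ) (h2 : γ < 2) :
    ∃ ρ, DR ρ (fun z => z) (fun z => z ^ (γ:ℂ)) := by
  have ht : |1 - γ| < 1 := by rw [abs_lt]; constructor <;> linarith
  have hR : ∀ z ∈ RH, z ^ ((1 - γ : ℝ):ℂ) ∈ RH := fun z hz => cpow_RH hz ht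
  have h1 : (1:ℂ) ∈ RH := by simp [RH]
  have hn : ∀ z ∈ RH, z ^ ((1 - γ : ℝ):ℂ) + 1 ≠ 0 := fun z hz => RH_add (hR z hz) h1
  have hd : DifferentiableOn ℂ (fun z => z ^ ((1 - γ : ℝ):ℂ)) RH := by
    intro z hz
    apply DifferentiableAt.differentiableWithinAt
    exact DifferentiableAt.cpow_const differentiableAt_id (Or.inl hz)
  have cd : DifferentiableOn ℂ (fun z => (z ^ ((1 - γ : ℝ):ℂ) - 1) / (z ^ ((1 - γ : ℝ):ℂ) + 1)) RH :=
    DifferentiableOn.div (by fun_prop) (by fun_prop) hn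
  obtain ⟨ψ, ψd, ψb, ψi⟩ := factor_RH h1 cd (fun z hz => cay_le (hR z hz)) (by simp)
  have ψc := ψd.continuousOn
  rw [map_one] at ψi
  refine ⟨ψ, ψd, ψb, ?_, ?_⟩
  · have ψs0 : ∀ z ∈ RH, ψ z = (starRingEnd ℂ) (ψ ((starRingEnd ℂ) z)) := by
      apply ext_off (S := {1}) (by simp) ψc (continuousOn_conj ψc)
      intro z hz hzS
      apply mul_left_cancel₀ (sub_ne_zero.2 hzS)
      rw [← ψi z hz]
      have := congrArg (starRingEnd ℂ) (ψi _ (conj_RH hz))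
      rw [conj_cpow_RH hz] at this
      simp only [map_mul, map_add, map_sub, map_div₀, map_one, Complex.conj_conj] at this
      exact this
    intro z hz
    have := ψs0 _ (conj_RH hz)
    rwa [Complex.conj_conj] at this
  · intro z hz
    have e1 : z ^ ((1 - γ : ℝ):ℂ) * z ^ (γ:ℂ) = z := by
      rw [← Complex.cpow_add _ _ (RH_ne hz)]
      push_cast; simp
    have e2 := ψi z hz
    have e3 := div_mul_cancel₀ (z ^ ((1 - γ : ℝ):ℂ) - 1) (hn z hz)
    generalize (z ^ ((1 - γ : ℝ):ℂ) - 1) / (z ^ ((1 - γ : ℝ):ℂ) + 1) = χ at *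
    generalize z ^ ((1 - γ : ℝ):ℂ) = h at *
    generalize z ^ (γ:ℂ) = g at *
    show ψ z * (z - 1) * (z + g) = (z + 1) * (z - g)
    linear_combination -(h+1)*g * e2 + (z+1)*g*e3 + (z + 1 - ψ z * (z-1)) * e1

namespace ZSetup
variable {γ : ℝ} {f : ℕ → ℕ → ℂ}

lemma diag_ind (H : ZSetup γ f) {R : ℕ → ℕ → ℝ} {e : ℕ → ℕ → ℂ} (K : Kites γ f R e)
    {E1 E2 : ℕ → ℕ → ℂ → ℂ} (L : Lax γ f E1 E2) (n : ℕ) :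
    0 < R n n ∧ (∃ x : ℝ, 0 ≤ x ∧ f n n = ea γ * x) ∧
      ∃ ρ, DR ρ (fun z => z * E1 n n z) (fun z => R n n * ea γ * E2 n n z) := by
  induction n with
  | zero =>
    have hR : R 0 0 = 1 := by rw [K.ax]; rfl
    refine ⟨by rw [hR]; norm_num, ⟨0, le_refl _, by simp [H.f00]⟩, ?_⟩
    obtain ⟨ρ, h⟩ := DR_base H.h0 H.h2
    refine ⟨ρ, ?_⟩
    have h1 : (fun z => z * E1 0 0 z) = fun z => z := by funext z; rw [L.i1, mul_one]
    have h2 : (fun z => (R 0 0 : ℂ) * ea γ * E2 0 0 z) = fun z => z ^ (γ:ℂ) := by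
      funext z
      rw [L.i2, hR]
      have := ea_conj γ
      push_cast
      linear_combination (z ^ (γ:ℂ)) * this
    rw [h1, h2]; exact h
  | succ n ih =>
    obtain ⟨hR, ⟨x, hx0, hx⟩, ρ, hρ⟩ := ih
    have hev : Even (n + n) := ⟨n, rfl⟩
    have hod : ¬ Even (n + 1 + n) := by
      rw [show n + 1 + n = n + n + 1 by ring, Nat.even_add_one]; simp
    have hev' : Even (n + 1 + (n + 1)) := ⟨n+1, rfl⟩
    have hu := K.eu n n hev
    have hv := K.ov (n+1) n hod
    have hR'0 := K.ne (n+1) (n+1) hev'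
    have hno := K.no (n+1) n hod
    have hea := ea_conj γ
    obtain ⟨ε, hε⟩ : ∃ ε, ε = e (n+1) n * (starRingEnd ℂ) (ea γ) := ⟨_, rfl⟩
    have hee : e (n+1) n = ea γ * ε := by rw [hε]; linear_combination -(e (n+1) n) * hea
    obtain ⟨c, hc⟩ : ∃ c, c = ε.re := ⟨_, rfl⟩
    obtain ⟨σ, hσ⟩ : ∃ σ, σ = -ε.im := ⟨_, rfl⟩
    have hεc : ε = c - I * σ := by
      apply Complex.ext <;> simp [hc, hσ]
    have hcs : c^2 + σ^2 = 1 := by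
      have : ‖ε‖ = 1 := by rw [hε, norm_mul, Complex.norm_conj, ea_norm, hno, one_mul]
      have h2 : Complex.normSq ε = 1 := by rw [Complex.normSq_eq_norm_sq, this]; norm_num
      rw [Complex.normSq_apply] at h2
      rw [hc, hσ]; linarith
    rw [hεc] at hee
    rw [hee] at hu hv
    obtain ⟨x', hx'⟩ := H.diag (n+1)
    have hsum : (c - I * σ) * (R n n + I * R (n+1) (n+1)) = ((x' - x : ℝ) : ℂ) := by
      apply mul_left_cancel₀ (ea_ne γ)
      have h1 : uu f n n + vv f (n+1) n = ea γ * x' - ea γ * x := by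
        rw [← hx, ← hx']; unfold uu vv; ring
      rw [hu, hv] at h1
      push_cast
      linear_combination h1
    have him := congrArg Complex.im hsum
    have hre := congrArg Complex.re hsum
    simp at him hre
    have hrel : c * R (n+1) (n+1) = σ * R n n := by linarith
    obtain ⟨hc0, hσ0, hnode⟩ := diag_pos (a := fun z => z * E1 n n z)
      (b := fun z => R n n * ea γ * E2 n n z) (ρ := ρ) hR hR'0 hcs hrel
      (by rw [L.p, hu]; ring)
      (by
        have : (R n n : ℂ) ≠ 0 := by exact_mod_cast hR.ne'
        exact mul_ne_zero (mul_ne_zero this (ea_ne γ)) (L.pn n n)) hρ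
    have hR' : 0 < R (n+1) (n+1) := by
      by_contra hcon
      push Not at hcon
      nlinarith [mul_pos hσ0 hR]
    refine ⟨hR', ⟨x', ?_, hx'⟩, ?_⟩
    · nlinarith [mul_pos hc0 hR, mul_pos hσ0 hR']
    have d1 := (L.d1 (n+1) (n+1)).continuousOn
    have d2 := (L.d2 (n+1) (n+1)).continuousOn
    have hune := uu_ne H.q n n
    have hvne := vv_ne H.q (n+1) n
    have hrelC : (c:ℂ) * R (n+1) (n+1) = σ * R n n := by exact_mod_cast hrel
    have hcsC : (c:ℂ)^2 + σ^2 = 1 := by exact_mod_cast hcs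
    have key : ∀ z ∈ RH, (lam z - 1) * E1 (n+1) n z = E1 n n z - uu f n n * E2 n n z ∧
        (lam z - 1) * E2 (n+1) n z * uu f n n = -lam z * E1 n n z + uu f n n * E2 n n z ∧
        E1 (n+1) (n+1) z = E1 (n+1) n z - vv f (n+1) n * E2 (n+1) n z ∧
        E2 (n+1) (n+1) z * vv f (n+1) n = lam z * E1 (n+1) n z + vv f (n+1) n * E2 (n+1) n z := by
      intro z hz
      refine ⟨L.h1 n n z hz, ?_, L.v1 _ _ z, ?_⟩
      · rw [L.h2 n n z hz]; field_simp
      · rw [L.v2]; field_simp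
    refine diag_step hc0 hσ0 hcs hρ (by fun_prop) (by fun_prop) hnode ?_ ?_
    · intro z hz
      obtain ⟨L1, L2, V1, V2⟩ := key z hz
      have hΛ : I * lam z = z^2 := by unfold lam; linear_combination -z^2 * Complex.I_sq
      apply mul_right_cancel₀ hune
      have k1 : (c:ℂ) * vv f (n+1) n = I * σ * uu f n n := by
        rw [hu, hv]; linear_combination I * (ea γ * (c - I * σ)) * hrelC
      have k2 : (c:ℂ) * (uu f n n + vv f (n+1) n) = R n n * ea γ := by
        rw [mul_add, k1, hu]
        linear_combination (R n n * ea γ) * hcsC - R n n * ea γ * σ^2 * Complex.I_sq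
      rw [V1]
      generalize uu f n n = u at *
      generalize vv f (n+1) n = v at *
      linear_combination c * z * u * L1 - c * z * v * L2 + z * lam z * E1 n n z * k1 - z * E2 n n z * u * k2 + z * E1 n n z * σ * u * hΛ
    · intro z hz
      obtain ⟨L1, L2, V1, V2⟩ := key z hz
      have hΛ : lam z = -I * z^2 := rfl
      apply mul_right_cancel₀ (mul_ne_zero hune hvne)
      have k3 : (R (n+1) (n+1) : ℂ) * I * uu f n n = R n n * vv f (n+1) n := by
        rw [hu, hv]; ring
      have k4 : I * c * R (n+1) (n+1) * ea γ * (uu f n n - vv f (n+1) n)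
          = uu f n n * vv f (n+1) n := by
        rw [hu, hv]
        linear_combination -I^2 * R (n+1) (n+1) * ea γ * (ea γ * (c - I * σ)) * hrelC
      generalize uu f n n = u at *
      generalize vv f (n+1) n = v at *
      linear_combination (lam z - 1) * c * R (n+1) (n+1) * ea γ * u * V2 + c * R (n+1) (n+1) * ea γ * u * lam z * L1 + c * R (n+1) (n+1) * ea γ * v * L2 + ea γ * E2 n n z * u * v * hrelC - c * u * ea γ * E2 n n z * (R (n+1) (n+1) * u * hΛ - z^2 * k3) + E1 n n z * (c * R (n+1) (n+1) * ea γ * (u - v) * hΛ - z^2 * k4)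

end ZSetup

lemma alg_LL {L D Q : ℝ} (hL : 0 < L) (hD : 0 < D) (hQ : 0 < Q) {e eLD eLL : ℂ} (he : e ≠ 0)
    (h1 : eLD * (Q + I * L) = eLL * (L + I * Q)) (h2 : eLD * (D - I * L) = e * (L - I * D)) :
    (L * e) * (L * eLL) / (L * e + L * eLL) = e * ((L - I * D) * (Q + I * L)) / (2 * (D + Q)) := by
  have hs : ((D:ℂ) + Q) ≠ 0 := by
    have : D + Q ≠ 0 := by positivity
    exact_mod_cast this
  have hLc : (L:ℂ) ≠ 0 := by exact_mod_cast hL.ne'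
  have k1 : ((D:ℂ) - I * L) ≠ 0 := by
    intro h; have := congrArg Complex.re h; simp at this; linarith
  have k2 : ((L:ℂ) + I * Q) ≠ 0 := by
    intro h; have := congrArg Complex.re h; simp at this; linarith
  have hN : eLL * ((D - I * L) * (L + I * Q)) = e * ((L - I * D) * (Q + I * L)) := by
    linear_combination (Q + I * L) * h2 - (D - I * L) * h1
  have hsum : (e + eLL) * ((D - I * L) * (L + I * Q)) = e * (2 * L * (D + Q)) := by
    linear_combination hN + e * (-L * Q - L * D) * I_sq
  have hne : e + eLL ≠ 0 := by
    intro h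
    rw [h, zero_mul] at hsum
    exact mul_ne_zero he (mul_ne_zero (mul_ne_zero two_ne_zero hLc) hs) hsum.symm
  have hne2 : (L:ℂ) * e + L * eLL ≠ 0 := by rw [← mul_add]; exact mul_ne_zero hLc hne
  rw [div_eq_div_iff hne2 (mul_ne_zero two_ne_zero hs)]
  apply mul_right_cancel₀ (mul_ne_zero k1 k2)
  linear_combination (L * e * L * 2 * (D + Q)) * hN - e * ((L - I * D) * (Q + I * L)) * L * hsum

lemma alg_UD {L D U : ℝ} (hL : 0 < L) (hD : 0 < D) (hU : 0 < U) {e eLD eLU : ℂ} (he : e ≠ 0)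
    (h1 : e * (L + I * U) = eLU * (U + I * L)) (h2 : eLD * (D - I * L) = e * (L - I * D)) :
    (I * L * eLU) * (I * L * eLD) / (I * L * eLU + I * L * eLD)
      = I * e * ((L + I * U) * (L - I * D)) / (2 * (U + D)) := by
  have hs : ((U:ℂ) + D) ≠ 0 := by
    have : U + D ≠ 0 := by positivity
    exact_mod_cast this
  have hLc : (L:ℂ) ≠ 0 := by exact_mod_cast hL.ne'
  have k1 : ((D:ℂ) - I * L) ≠ 0 := by
    intro h; have := congrArg Complex.re h; simp at this; linarith
  have k2 : ((U:ℂ) + I * L) ≠ 0 := by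
    intro h; have := congrArg Complex.re h; simp at this; linarith
  have hsum : (eLU + eLD) * ((D - I * L) * (U + I * L)) = e * (2 * L * (U + D)) := by
    linear_combination -(D - I * L) * h1 + (U + I * L) * h2 + e * (-L * U - L * D) * I_sq
  have hne : eLU + eLD ≠ 0 := by
    intro h
    rw [h, zero_mul] at hsum
    exact mul_ne_zero he (mul_ne_zero (mul_ne_zero two_ne_zero hLc) hs) hsum.symm
  have hne2 : I * L * eLU + I * L * eLD ≠ 0 := by
    rw [← mul_add]; exact mul_ne_zero (mul_ne_zero I_ne_zero hLc) hne
  rw [div_eq_div_iff hne2 (mul_ne_zero two_ne_zero hs)]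
  apply mul_right_cancel₀ (mul_ne_zero k1 k2)
  have hp : (eLU * (U + I * L)) * (eLD * (D - I * L)) = (e * (L + I * U)) * (e * (L - I * D)) := by
    rw [← h1, h2]
  linear_combination I^2 * L^2 * (2 * (U + D)) * hp - I * e * ((L + I * U) * (L - I * D)) * I * L * hsum

lemma alg_site {γ n m L D U Q : ℝ} {S T : ℝ} (hL : 0 < L) (hD : 0 < D) (hU : 0 < U) (hQ : 0 < Q)
    {e p pL : ℂ} (he : e ≠ 0) (h1 : (γ:ℂ) * p = e * (S + I * T)) (h2 : p = pL + L * e)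
    (h3 : (γ:ℂ) * pL = 2 * (n - 1) * (e * ((L - I * D) * (Q + I * L)) / (2 * (D + Q)))
      + 2 * m * (I * e * ((L + I * U) * (L - I * D)) / (2 * (U + D)))) :
    S / L = γ + n - 1 - m * ((U - D) / (U + D)) := by
  have hs : D + Q ≠ 0 := by positivity
  have ht : U + D ≠ 0 := by positivity
  have hsc : ((D:ℂ) + Q) ≠ 0 := by exact_mod_cast hs
  have htc : ((U:ℂ) + D) ≠ 0 := by exact_mod_cast ht
  have h4 : (S + I * T : ℂ) = ((γ * L + (n - 1) * L - m * (L * (U - D) / (U + D)) : ℝ) : ℂ)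
      + I * (((n-1) * ((L^2 - D * Q)/ (D + Q)) + m * ((L^2 + U * D)/ (U + D)) : ℝ) : ℂ) := by
    apply mul_left_cancel₀ he
    rw [← h1, h2, mul_add, h3]
    push_cast
    field_simp
    ring_nf
    simp only [I_sq, show I^3 = -I by rw [pow_succ, I_sq]; ring]
    ring
  have h5 := congrArg Complex.re h4
  simp only [Complex.add_re, Complex.ofReal_re, Complex.I_mul_re, Complex.ofReal_im, neg_zero, add_zero] at h5
  rw [h5]
  field_simp
  ring

lemma alg_pos {γ n m L D U R : ℝ} (hL : 0 < L) (hD : 0 < D) (hU : 0 < U) (hR : R ≠ 0)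
    (h0 : 0 < γ) (h2 : γ < 2) (hm : 0 < m) (hnm : m + 1 ≤ n)
    (h : 2 * n * (R * L / (R + L)) / L = γ + n - 1 - m * ((U - D) / (U + D))) :
    0 < R ∧ 2 * n * R / (R + L) + 2 * m * U / (U + D) - γ = n + m - 1 := by
  have ht : 0 < U + D := by positivity
  have hq1 : (U - D) / (U + D) < 1 := by rw [div_lt_iff₀ ht]; linarith
  have hq2 : -1 < (U - D) / (U + D) := by rw [lt_div_iff₀ ht]; linarith
  have hq3 : 2 * m * U / (U + D) = m * ((U - D) / (U + D)) + m := by field_simp; ring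
  have hX : 2 * n * (R * L / (R + L)) / L = 2 * n * R / (R + L) := by
    field_simp
  rw [hX] at h
  refine ⟨?_, by rw [hq3]; linarith⟩
  generalize (U - D) / (U + D) = q at *
  have hmq : m * q < m := by nlinarith
  have hmq2 : -m < m * q := by nlinarith
  have hS : R + L ≠ 0 := by
    intro hS
    rw [hS, div_zero] at h
    linarith
  have h5 : 2 * n * R = (γ + n - 1 - m * q) * (R + L) := by rw [← h]; field_simp
  have hX1 : 0 < γ + n - 1 - m * q := by linarith
  have hX2 : γ + n - 1 - m * q < 2 * n := by linarith
  generalize γ + n - 1 - m * q = X at *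
  have h6 : R * (2 * n - X) = X * L := by linarith
  by_contra hcon
  push Not at hcon
  nlinarith [mul_pos hX1 hL]

namespace ZSetup
variable {γ : ℝ} {f : ℕ → ℕ → ℂ}

lemma hterm {R L : ℝ} {e : ℂ} (he : e ≠ 0) :
    (R * e) * (L * e) / (R * e + L * e) = e * ((R * L / (R + L) : ℝ) : ℂ) := by
  by_cases h : R + L = 0
  · have hc : (R:ℂ) + L = 0 := by exact_mod_cast h
    rw [← add_mul, hc, h]; simp
  · have hc : (R:ℂ) + L ≠ 0 := by exact_mod_cast h
    rw [← add_mul]; push_cast; field_simp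

lemma vterm {R L : ℝ} {e : ℂ} (he : e ≠ 0) :
    (I * R * e) * (I * L * e) / (I * R * e + I * L * e) = e * (I * ((R * L / (R + L) : ℝ) : ℂ)) := by
  have h1 := hterm (R := R) (L := L) (e := I * e) (mul_ne_zero I_ne_zero he)
  rw [show I * R * e = R * (I * e) by ring, show I * L * e = L * (I * e) by ring, h1]
  ring

lemma Kites.e_ne {R : ℕ → ℕ → ℝ} {e : ℕ → ℕ → ℂ} (K : Kites γ f R e) {n m : ℕ}
    (h : ¬ Even (n + m)) : e n m ≠ 0 := by
  intro h1
  have := K.no n m h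
  rw [h1] at this; simp at this

lemma c_uv (H : ZSetup γ f) (n m : ℕ) : (γ:ℂ) * f (n+1) (m+1) =
    2 * ((n:ℂ) + 1) * (uu f (n+1) (m+1) * uu f n (m+1) / (uu f (n+1) (m+1) + uu f n (m+1))) +
    2 * ((m:ℂ) + 1) * (vv f (n+1) (m+1) * vv f (n+1) m / (vv f (n+1) (m+1) + vv f (n+1) m)) := by
  have := H.c (n+1) (m+1)
  rw [this]
  simp only [Nat.add_sub_cancel, uu, vv, sub_add_sub_cancel]
  push_cast
  ring

lemma c_odd (H : ZSetup γ f) {R : ℕ → ℕ → ℝ} {e : ℕ → ℕ → ℂ} (K : Kites γ f R e) (n m : ℕ)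
    (h : Even (n + m + 1)) : (γ:ℂ) * f (n+1) (m+1) = e (n+1) (m+1) *
      (((2 * (n + 1) * (R (n+2) (m+1) * R n (m+1) / (R (n+2) (m+1) + R n (m+1))) : ℝ) : ℂ) +
      I * ((2 * (m + 1) * (R (n+1) (m+2) * R (n+1) m / (R (n+1) (m+2) + R (n+1) m)) : ℝ) : ℂ)) := by
  have ho : ¬ Even (n + 1 + (m + 1)) := by grind
  have he := K.e_ne ho
  rw [H.c_uv, K.ou _ _ ho, K.ov _ _ ho, K.eu n (m+1) (by grind), K.ev (n+1) m (by grind),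
    hterm he, vterm he]
  push_cast; ring

lemma c_odd0 (H : ZSetup γ f) {R : ℕ → ℕ → ℝ} {e : ℕ → ℕ → ℂ} (K : Kites γ f R e) (n : ℕ)
    (h : Even n) : (γ:ℂ) * f (n+1) 0 = e (n+1) 0 *
      ((2 * (n + 1) * (R (n+2) 0 * R n 0 / (R (n+2) 0 + R n 0)) : ℝ) : ℂ) := by
  have ho : ¬ Even (n + 1 + 0) := by grind
  have he := K.e_ne ho
  have h1 := hterm (R := R (n+2) 0) (L := R n 0) he
  rw [← K.ou _ _ ho, ← K.eu n 0 (by grind)] at h1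
  have := H.c (n+1) 0
  rw [this]
  simp only [Nat.add_sub_cancel, uu, sub_add_sub_cancel] at h1 ⊢
  push_cast at h1 ⊢
  linear_combination 2 * ((n:ℂ) + 1) * h1

lemma close_even {R : ℕ → ℕ → ℝ} {e : ℕ → ℕ → ℂ} (K : Kites γ f R e) (n m : ℕ)
    (h : Even (n + m)) : e (n+1) m * (R n m + I * R (n+1) (m+1))
      = e n (m+1) * (R (n+1) (m+1) + I * R n m) := by
  have := uv_close f n m
  rw [K.eu _ _ h, K.ov (n+1) m (by grind), K.ev _ _ h, K.ou n (m+1) (by grind)] at this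
  linear_combination this

lemma close_odd {R : ℕ → ℕ → ℝ} {e : ℕ → ℕ → ℂ} (K : Kites γ f R e) (n m : ℕ)
    (h : ¬ Even (n + m)) : e n m * (R (n+1) m - I * R n (m+1))
      = e (n+1) (m+1) * (R n (m+1) - I * R (n+1) m) := by
  have := uv_close f n m
  rw [K.ou _ _ h, K.ev (n+1) m (by grind), K.ov _ _ h, K.eu n (m+1) (by grind)] at this
  linear_combination this

lemma R_step (H : ZSetup γ f) {R : ℕ → ℕ → ℝ} {e : ℕ → ℕ → ℂ} (K : Kites γ f R e) (k j : ℕ)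
    (h : Even (k + j)) (hkj : j ≤ k) (hL : 0 < R (k+1) (j+1)) (hU : 0 < R (k+2) (j+2))
    (hD : 0 < R (k+2) j) (hQ : 0 < R k j) :
    0 < R (k+3) (j+1) ∧ 2 * ((k:ℝ) + 2) * R (k+3) (j+1) / (R (k+3) (j+1) + R (k+1) (j+1)) +
      2 * ((j:ℝ) + 1) * R (k+2) (j+2) / (R (k+2) (j+2) + R (k+2) j) - γ = k + j + 2 := by
  have hR := K.ne (k+3) (j+1) (by grind)
  have ho : ¬ Even (k + 2 + (j + 1)) := by grind
  have he := K.e_ne ho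
  have h1 := H.c_odd K (k+1) j (by grind)
  have h2 : f (k+2) (j+1) = f (k+1) (j+1) + R (k+1) (j+1) * e (k+2) (j+1) := by
    rw [← K.eu (k+1) (j+1) (by grind)]; unfold uu; ring
  have g1 := close_even K k j h
  have g2 := close_odd K (k+1) j (by grind)
  have g3 := close_even K (k+1) (j+1) (by grind)
  have h3 := H.c_uv k j
  rw [K.eu (k+1) (j+1) (by grind), K.ou k (j+1) (by grind), K.ev (k+1) (j+1) (by grind),
    K.ov (k+1) j (by grind), alg_LL hL hD hQ he g1 g2, alg_UD hL hD hU he g3 g2] at h3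
  have h4 := alg_site (n := k + 2) (m := j + 1) hL hD hU hQ he h1 h2
    (by rw [h3]; push_cast; ring)
  have h5 := alg_pos (n := k + 2) (m := j + 1) hL hD hU hR H.h0 H.h2 (by positivity)
    (by have : (j:ℝ) ≤ k := by exact_mod_cast hkj
        linarith) (by rw [← h4]; push_cast; ring)
  refine ⟨h5.1, ?_⟩
  have := h5.2
  linarith

lemma R_pos (H : ZSetup γ f) {R : ℕ → ℕ → ℝ} {e : ℕ → ℕ → ℂ} (K : Kites γ f R e)
    {E1 E2 : ℕ → ℕ → ℂ → ℂ} (L : Lax γ f E1 E2) (d : ℕ) : ∀ m, 0 < R (m + 2 * d) m := by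
  induction d with
  | zero => intro m; exact (H.diag_ind K L m).1
  | succ d ih =>
    intro m
    induction m with
    | zero => rw [K.ax]; exact UU_pos H.h0 H.h2 _
    | succ m ihm =>
      have h1 := ih (m+1)
      have h2 := ih (m+2)
      have h3 := ih m
      have := (H.R_step K (m + 2 * d) m (by grind) (by omega) (by convert h1 using 2; ring)
        (by convert h2 using 2; ring) (by convert ihm using 2; ring) h3).1
      convert this using 2; ring

lemma R_pos' (H : ZSetup γ f) {R : ℕ → ℕ → ℝ} {e : ℕ → ℕ → ℂ} (K : Kites γ f R e)
    {E1 E2 : ℕ → ℕ → ℂ → ℂ} (L : Lax γ f E1 E2) {n m : ℕ} (h : Even (n + m)) (hm : m ≤ n) :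
    0 < R n m := by
  obtain ⟨d, hd⟩ : ∃ d, n = m + 2 * d := by
    obtain ⟨r, hr⟩ := h
    exact ⟨r - m, by omega⟩
  rw [hd]; exact H.R_pos K L d m

end ZSetup

/-- linear description of the sector -/
def InB (γ : ℝ) (z : ℂ) : Prop := 0 ≤ z.im ∧ (z * (starRingEnd ℂ) (ea γ)).im ≤ 0

lemma ea_re {γ : ℝ} (h0 : 0 < γ) (h2 : γ < 2) : 0 < (ea γ).re := by
  unfold ea
  rw [Complex.exp_ofReal_mul_I_re]
  apply Real.cos_pos_of_mem_Ioo
  constructor <;> nlinarith [Real.pi_pos]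

lemma ea_im {γ : ℝ} (h0 : 0 < γ) (h2 : γ < 2) : 0 < (ea γ).im := by
  unfold ea
  rw [Complex.exp_ofReal_mul_I_im]
  apply Real.sin_pos_of_pos_of_lt_pi <;> nlinarith [Real.pi_pos]

lemma InB_comb {γ : ℝ} {z w : ℂ} (hz : InB γ z) (hw : InB γ w) {a b : ℝ} (ha : 0 ≤ a)
    (hb : 0 ≤ b) : InB γ (a * z + b * w) := by
  constructor
  · have h1 := mul_nonneg ha hz.1
    have h2 := mul_nonneg hb hw.1
    simpa using add_nonneg h1 h2
  · have e : ((a * z + b * w) * (starRingEnd ℂ) (ea γ)).im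
        = a * (z * (starRingEnd ℂ) (ea γ)).im + b * (w * (starRingEnd ℂ) (ea γ)).im := by
      rw [add_mul, mul_assoc, mul_assoc, Complex.add_im, Complex.im_ofReal_mul,
        Complex.im_ofReal_mul]
    rw [e]
    nlinarith [mul_nonneg ha (neg_nonneg.2 hz.2), mul_nonneg hb (neg_nonneg.2 hw.2)]

lemma InB_re {γ : ℝ} (h0 : 0 < γ) (h2 : γ < 2) {z : ℂ} (hz : InB γ z) :
    0 ≤ z.re ∧ 0 ≤ (z * (starRingEnd ℂ) (ea γ)).re := by
  have hc := ea_re h0 h2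
  have hs := ea_im h0 h2
  obtain ⟨h3, h4⟩ := hz
  simp only [Complex.mul_im, Complex.mul_re, Complex.conj_re, Complex.conj_im] at h4 ⊢
  have h5 : 0 ≤ z.re := by
    by_contra hcon
    push Not at hcon
    nlinarith [mul_nonneg h3 hc.le, mul_pos (neg_pos.2 hcon) hs]
  refine ⟨h5, ?_⟩
  nlinarith [mul_nonneg h5 hc.le, mul_nonneg h3 hs.le]

lemma InB_polar {γ : ℝ} (h0 : 0 < γ) (h2 : γ < 2) {z : ℂ} (hz : InB γ z) :
    ∃ r φ : ℝ, 0 ≤ r ∧ 0 ≤ φ ∧ φ ≤ γ * Real.pi / 4 ∧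
      z = (r : ℂ) * Complex.exp ((φ : ℂ) * Complex.I) := by
  have hpi := Real.pi_pos
  by_cases hz0 : z = 0
  · exact ⟨0, 0, le_refl _, le_refl _, by positivity, by simp [hz0]⟩
  have hn : 0 < ‖z‖ := norm_pos_iff.2 hz0
  have hp := (Complex.norm_mul_exp_arg_mul_I z).symm
  have ha := Complex.arg_nonneg_iff.2 hz.1
  refine ⟨‖z‖, z.arg, norm_nonneg _, ha, ?_, hp⟩
  by_contra hcon
  push Not at hcon
  have h1 : 0 < Real.sin (z.arg - γ * Real.pi / 4) := by
    apply Real.sin_pos_of_pos_of_lt_pi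
    · linarith
    · have := Complex.arg_le_pi z
      nlinarith
  have h3 := hz.2
  have e : (z * (starRingEnd ℂ) (ea γ)).im = ‖z‖ * Real.sin (z.arg - γ * Real.pi / 4) := by
    have h4 : (starRingEnd ℂ) (ea γ) = Complex.exp (-((γ * Real.pi / 4 : ℝ) * I)) := by
      unfold ea
      rw [← Complex.exp_conj]
      congr 1
      rw [map_mul, Complex.conj_ofReal, Complex.conj_I, mul_neg]
    conv_lhs => rw [hp, h4, mul_assoc, ← Complex.exp_add]
    rw [Complex.im_ofReal_mul]
    congr 1
    rw [← Complex.exp_ofReal_mul_I_im]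
    congr 2
    push_cast; ring
  rw [e] at h3
  nlinarith [mul_pos hn h1]

lemma rot_inv {γ a b : ℝ} {p e : ℂ} (h0 : 0 < γ) (ha : 0 < a)
    (h : (γ:ℂ) * p = e * (a + I * b)) : ∃ k : ℝ, 0 < k ∧ e = k * (p * (a - I * b)) := by
  have hs : a^2 + b^2 ≠ 0 := by positivity
  have hsc : (a:ℂ)^2 + b^2 ≠ 0 := by exact_mod_cast hs
  refine ⟨γ / (a^2 + b^2), by positivity, ?_⟩
  push_cast
  rw [div_mul_eq_mul_div, eq_div_iff hsc]
  linear_combination -(a - I * b) * h + e * b^2 * I_sq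

namespace ZSetup
variable {γ : ℝ} {f : ℕ → ℕ → ℂ}

lemma inB_odd (H : ZSetup γ f) {R : ℕ → ℕ → ℝ} {e : ℕ → ℕ → ℂ} (K : Kites γ f R e)
    {E1 E2 : ℕ → ℕ → ℂ → ℂ} (L : Lax γ f E1 E2) (k j : ℕ) (h : Even (k + j)) (hkj : j ≤ k)
    (h1 : InB γ (f (k+1) (j+1))) (h2 : InB γ (f (k+2) j)) : InB γ (f (k+2) (j+1)) := by
  have pL : 0 < R (k+1) (j+1) := H.R_pos' K L (by grind) (by omega)
  have pU : 0 < R (k+2) (j+2) := H.R_pos' K L (by grind) (by omega)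
  have pD : 0 < R (k+2) j := H.R_pos' K L (by grind) (by omega)
  have pQ : 0 < R k j := H.R_pos' K L (by grind) (by omega)
  obtain ⟨pR, h9⟩ := H.R_step K k j h hkj pL pU pD pQ
  have hc := H.c_odd K (k+1) j (by grind)
  have e1 : f (k+2) (j+1) = f (k+1) (j+1) + R (k+1) (j+1) * e (k+2) (j+1) := by
    rw [← K.eu (k+1) (j+1) (by grind)]; unfold uu; ring
  have e2 : f (k+2) (j+1) = f (k+2) j + I * R (k+2) j * e (k+2) (j+1) := by
    rw [← K.ev (k+2) j (by grind)]; unfold vv; ring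
  obtain ⟨A, hA⟩ : ∃ A, A = 2 * ((k:ℝ) + 2) * R (k+3) (j+1) / (R (k+3) (j+1) + R (k+1) (j+1)) :=
    ⟨_, rfl⟩
  obtain ⟨B, hB⟩ : ∃ B, B = 2 * ((j:ℝ) + 1) * R (k+2) (j+2) / (R (k+2) (j+2) + R (k+2) j) :=
    ⟨_, rfl⟩
  have hA0 : 0 ≤ A := by rw [hA]; positivity
  have hB0 : 0 ≤ B := by rw [hB]; positivity
  rw [← hA, ← hB] at h9
  have c1 : 2 * (((k + 1 : ℕ) : ℝ) + 1) * (R (k+1+2) (j+1) * R (k+1) (j+1) /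
      (R (k+1+2) (j+1) + R (k+1) (j+1))) = A * R (k+1) (j+1) := by
    rw [hA]; push_cast; ring
  have c2 : 2 * ((j : ℝ) + 1) * (R (k+1+1) (j+2) * R (k+1+1) j /
      (R (k+1+1) (j+2) + R (k+1+1) j)) = B * R (k+2) j := by
    rw [hB]; ring
  rw [c1, c2] at hc
  have h9c : (A:ℂ) + B - γ = k + j + 2 := by exact_mod_cast h9
  have hs : (0:ℝ) < k + j + 2 := by positivity
  have hsc : (k:ℂ) + j + 2 ≠ 0 := by exact_mod_cast hs.ne'
  have hcomb : f (k+2) (j+1) = ((A / (k + j + 2) : ℝ):ℂ) * f (k+1) (j+1)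
      + ((B / (k + j + 2) : ℝ) : ℂ) * f (k+2) j := by
    push_cast
    field_simp
    push_cast at hc
    linear_combination -f (k+2) (j+1) * h9c - hc + A * e1 + B * e2
  rw [hcomb]
  exact InB_comb h1 h2 (by positivity) (by positivity)

lemma c_odd_pos (H : ZSetup γ f) {R : ℕ → ℕ → ℝ} {e : ℕ → ℕ → ℂ} (K : Kites γ f R e)
    {E1 E2 : ℕ → ℕ → ℂ → ℂ} (L : Lax γ f E1 E2) (n m : ℕ) (h : Even (n + m)) (hm : m ≤ n) :
    ∃ a b : ℝ, 0 < a ∧ 0 ≤ b ∧ (γ:ℂ) * f (n+1) m = e (n+1) m * (a + I * b) := by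
  cases m with
  | zero =>
    have p1 : 0 < R (n+2) 0 := H.R_pos' K L (by grind) (by omega)
    have p2 : 0 < R n 0 := H.R_pos' K L (by grind) (by omega)
    refine ⟨2 * (n + 1) * (R (n+2) 0 * R n 0 / (R (n+2) 0 + R n 0)), 0, ?_, le_refl _, ?_⟩
    rotate_left
    · rw [H.c_odd0 K n (by simpa using h)]
      rw [Complex.ofReal_zero, mul_zero, add_zero]
    · positivity
  | succ m =>
    have p1 : 0 < R (n+2) (m+1) := H.R_pos' K L (by grind) (by omega)
    have p2 : 0 < R n (m+1) := H.R_pos' K L (by grind) (by omega)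
    have p3 : 0 < R (n+1) (m+2) := H.R_pos' K L (by grind) (by omega)
    have p4 : 0 < R (n+1) m := H.R_pos' K L (by grind) (by omega)
    refine ⟨_, _, ?_, ?_, H.c_odd K n m (by grind)⟩
    · positivity
    · positivity

lemma inB_even (H : ZSetup γ f) {R : ℕ → ℕ → ℝ} {e : ℕ → ℕ → ℂ} (K : Kites γ f R e)
    {E1 E2 : ℕ → ℕ → ℂ → ℂ} (L : Lax γ f E1 E2) (k j : ℕ) (h : Even (k + j + 1)) (hkj : j + 1 ≤ k)
    (h1 : InB γ (f (k+1) (j+1))) (h2 : InB γ (f (k+2) j)) : InB γ (f (k+2) (j+1)) := by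
  have pR : 0 < R (k+2) (j+1) := H.R_pos' K L (by grind) (by omega)
  constructor
  · obtain ⟨a, b, ha, hb, hc⟩ := H.c_odd_pos K L (k+1) j (by grind) (by omega)
    obtain ⟨q, hq, he⟩ := rot_inv H.h0 ha hc
    have e2 : f (k+2) (j+1) = f (k+2) j + I * R (k+2) (j+1) * e (k+2) j := by
      rw [← K.ov (k+2) j (by grind)]; unfold vv; ring
    rw [show k + 1 + 1 = k + 2 from rfl] at he
    rw [e2, he]
    have e3 : (f (k+2) j + I * R (k+2) (j+1) * (q * (f (k+2) j * (a - I * b)))).im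
        = (f (k+2) j).im + R (k+2) (j+1) * q * (a * (f (k+2) j).re + b * (f (k+2) j).im) := by
      simp; ring
    rw [e3]
    have := (InB_re H.h0 H.h2 h2).1
    have := h2.1
    positivity
  · obtain ⟨a, b, ha, hb, hc⟩ := H.c_odd_pos K L k (j+1) (by grind) (by omega)
    obtain ⟨q, hq, he⟩ := rot_inv H.h0 ha hc
    have e2 : f (k+2) (j+1) = f (k+1) (j+1) + R (k+2) (j+1) * e (k+1) (j+1) := by
      rw [← K.ou (k+1) (j+1) (by grind)]; unfold uu; ring
    rw [e2, he]
    have w1 := (InB_re H.h0 H.h2 h1).2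
    have w2 := h1.2
    have e3 : ((f (k+1) (j+1) + R (k+2) (j+1) * (q * (f (k+1) (j+1) * (a - I * b)))) *
        (starRingEnd ℂ) (ea γ)).im = ((f (k+1) (j+1) * (starRingEnd ℂ) (ea γ)) +
        R (k+2) (j+1) * q * ((f (k+1) (j+1) * (starRingEnd ℂ) (ea γ)) * (a - I * b))).im := by
      congr 1; ring
    rw [e3]
    generalize f (k+1) (j+1) * (starRingEnd ℂ) (ea γ) = w at *
    have e4 : (w + R (k+2) (j+1) * q * (w * (a - I * b))).im
        = -(-w.im + R (k+2) (j+1) * q * (a * (-w.im) + b * w.re)) := by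
      simp; ring
    rw [e4]
    have : 0 ≤ -w.im := by linarith
    have : 0 ≤ -w.im + R (k+2) (j+1) * q * (a * (-w.im) + b * w.re) := by positivity
    linarith

lemma inB (H : ZSetup γ f) : ∀ s n m : ℕ, n + m = s → m ≤ n → InB γ (f n m) := by
  obtain ⟨R, e, K⟩ := H.kites
  obtain ⟨E1, E2, L⟩ := H.lax
  have hs := ea_im H.h0 H.h2
  intro s
  induction s using Nat.strong_induction_on with
  | _ s ih =>
    intro n m hs' hm
    rcases Nat.eq_zero_or_pos m with rfl | hm0
    · obtain ⟨x, hx0, hx⟩ := H.ax_real n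
      rw [hx]
      constructor
      · simp
      · rw [Complex.im_ofReal_mul, Complex.conj_im]
        nlinarith [mul_nonneg hx0 hs.le]
    rcases Nat.eq_or_lt_of_le hm with rfl | hlt
    · obtain ⟨x, hx0, hx⟩ := (H.diag_ind K L m).2.1
      rw [hx]
      constructor
      · rw [mul_comm, Complex.im_ofReal_mul]; positivity
      · rw [show ea γ * x * (starRingEnd ℂ) (ea γ) = x * (ea γ * (starRingEnd ℂ) (ea γ)) by ring,
          ea_conj]
        simp
    obtain ⟨j, rfl⟩ : ∃ j, m = j + 1 := ⟨m - 1, by omega⟩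
    obtain ⟨k, rfl⟩ : ∃ k, n = k + 2 := ⟨n - 2, by omega⟩
    have i1 : InB γ (f (k+1) (j+1)) := ih (k + 1 + (j + 1)) (by omega) _ _ rfl (by omega)
    have i2 : InB γ (f (k+2) j) := ih (k + 2 + j) (by omega) _ _ rfl (by omega)
    by_cases hp : Even (k + j)
    · exact H.inB_odd K L k j hp (by omega) i1 i2
    · exact H.inB_even K L k j (by grind) (by grind) i1 i2

end ZSetup

/-- for `0 ≤ m ≤ n` the point `Z^γ(n,m)` lies in the closed sector
`B = {r e^{iφ} : r ≥ 0, 0 ≤ φ ≤ γπ/4}`. -/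
theorem stmt19 (γ : ℝ) (hγ0 : 0 < γ) (hγ2 : γ < 2)
    (f : ℕ → ℕ → ℂ) (hq : CrossRatioEq f) (hc : ConstraintC γ f)
    (hinit : InitialData f (γ * Real.pi / 2)) :
    ∀ n m : ℕ, m ≤ n → ∃ r φ : ℝ, 0 ≤ r ∧ 0 ≤ φ ∧ φ ≤ γ * Real.pi / 4 ∧
      f n m = (r : ℂ) * Complex.exp ((φ : ℂ) * Complex.I) := by
  intro n m hm
  have H : ZSetup γ f := ⟨hγ0, hγ2, hq, hc, hinit⟩
  exact InB_polar hγ0 hγ2 (H.inB (n + m) n m rfl hm)
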